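/- List-decoding theorem for power families (Theorem 1.3): Let F = F_q be a finite field, L : F[X,Y] → F[X,Y] a linear operator that is degree-preserving in both X and Y, A = ((x_0,y_0),…,(x_{n−1},y_{n−1})) a list of n points of F×F, and t, k degree parameters with tk ≤ sn, where 𝓛 = (L^0, L^1, …, L^{s−1}) is a linearly-extendible bivariate family of linear operators (L^i being the i-fold composition of L). Let 1 ≤ w ≤ s and set 𝓣 = (L^0,…,L^{s−w}). Suppose d1 ≥ t and d2 ≥ k satisfy w(d1−t+1)(d2−k+1) > n(s−w+1), and suppose D is a natural number such that every nonzero R ∈ F[X,Y] with deg_X R < d1 and deg_Y R < d2 has 𝓣(R)(x_i,y_i) ≠ 0 for at least D indices i, and that for every nonzero u ∈ F^s the vector u·Diag(𝓛) ∈ F^{tk} has at most ℓ zero entries. Then for every received word c ∈ (F^s)^n, the number of polynomials p with deg_X p < t and deg_Y p < k whose encoding (𝓛(p)(x_i,y_i))_i disagrees with c in fewer than D coordinates is at most q^ℓ. -/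

import Mathlib

open MvPolynomial

noncomputable section

/-- `deg_X p < t` and `deg_Y p < k` (with the convention `deg 0 = -∞`). -/
def DegLT (F : Type) [Field F] (t k : ℕ) (p : MvPolynomial (Fin 2) F) : Prop :=
  ∀ m ∈ p.support, m 0 < t ∧ m 1 < k

/-- A bivariate family of linear operators is linearly-extendible, witnessed by
matrices `Mx`, `My` over `F[X,Y]`. -/
def LinExt (F : Type) [Field F] (s : ℕ)
    (L : Fin s → MvPolynomial (Fin 2) F →ₗ[F] MvPolynomial (Fin 2) F)
    (Mx My : Matrix (Fin s) (Fin s) (MvPolynomial (Fin 2) F)) : Prop :=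
  (∀ p, (fun i => L i (X 0 * p)) = Mx.mulVec fun i => L i p) ∧
  (∀ p, (fun i => L i (X 1 * p)) = My.mulVec fun i => L i p)

/-- The `(j, (a,b))` entry of `Diag(𝓛)`: the coefficient of `X^a Y^b` in `L_j(X^a Y^b)`. -/
def diagEntry (F : Type) [Field F]
    (G : MvPolynomial (Fin 2) F →ₗ[F] MvPolynomial (Fin 2) F) (a b : ℕ) : F :=
  MvPolynomial.coeff (Finsupp.single 0 a + Finsupp.single 1 b) (G (X 0 ^ a * X 1 ^ b))

namespace Polynomial

/-- Two polynomials of degree less than `#C` that agree on `C` are equal. -/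
theorem poly_eq_of_agree {F : Type*} [Field F] {C : Finset F} {P Q : F[X]} {m : ℕ}
    (hP : P.natDegree ≤ m) (hQ : Q.natDegree ≤ m) (hm : m < C.card)
    (h : ∀ x ∈ C, P.eval x = Q.eval x) : P = Q := by
  refine Polynomial.eq_of_natDegree_lt_card_of_eval_eq' P Q C h ?_
  exact lt_of_le_of_lt (max_le hP hQ) hm

section Rigidity

variable {F : Type*} [Field F] {C : Finset F} {s : ℕ} {G : F[X]}

theorem natDegree_prod_X_sub_C_id (Z : Finset F) :
    (∏ z ∈ Z, (X - Polynomial.C z)).natDegree = Z.card := by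
  simp

theorem eval_prod_X_sub_C_ne_zero {Z : Finset F} {x : F} (hx : x ∉ Z) :
    (∏ z ∈ Z, (X - Polynomial.C z)).eval x ≠ 0 := by
  rw [eval_prod, Finset.prod_ne_zero_iff]
  intro z hz
  simp only [eval_sub, eval_X, eval_C]
  exact sub_ne_zero.2 fun h => hx (h ▸ hz)

theorem eval_prod_X_sub_C_eq_zero {Z : Finset F} {x : F} (hx : x ∈ Z) :
    (∏ z ∈ Z, (X - Polynomial.C z)).eval x = 0 := by
  rw [eval_prod]
  exact Finset.prod_eq_zero hx (by simp)

/-- Substitution of `G` maps polynomials of degree `< s` to such polynomials, as functions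
on `C`. -/
def SubstClosed (C : Finset F) (s : ℕ) (G : F[X]) : Prop :=
  ∀ P : F[X], P.natDegree < s → ∃ P' : F[X], P'.natDegree < s ∧
    ∀ x ∈ C, P'.eval x = P.eval (G.eval x)

variable [DecidableEq F]

/-- If the image of `C` has at least `s` points, then `G` is injective on `C`. -/
theorem SubstClosed.injOn (hG : SubstClosed C s G) (hs : 2 ≤ s)
    (hcard : s ≤ (C.image fun x => G.eval x).card) :
    Set.InjOn (fun x => G.eval x) C := by
  classical
  let φ : degreeLT F s →ₗ[F] (C → F) :=
    (LinearMap.pi fun x : C => Polynomial.leval (G.eval (x : F))) ∘ₗ (degreeLT F s).subtype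
  let ε : degreeLT F s →ₗ[F] (C → F) :=
    (LinearMap.pi fun x : C => Polynomial.leval (x : F)) ∘ₗ (degreeLT F s).subtype
  have hdeg : ∀ P : degreeLT F s, (P : F[X]).natDegree ≤ s - 1 := fun P => by
    have := mem_degreeLT.1 P.2
    by_cases h0 : (P : F[X]) = 0
    · simp [h0]
    · have := (Polynomial.natDegree_lt_iff_degree_lt h0).2 this
      omega
  have hφ : Function.Injective φ := by
    rw [← LinearMap.ker_eq_bot, LinearMap.ker_eq_bot']
    intro P hP
    apply Subtype.ext
    refine poly_eq_of_agree (C := C.image fun x => G.eval x) (hdeg P) (by simp) (by omega) ?_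
    intro y hy
    obtain ⟨x, hx, rfl⟩ := Finset.mem_image.1 hy
    simpa [φ] using congrFun hP ⟨x, hx⟩
  have hC : s ≤ C.card := hcard.trans Finset.card_image_le
  have hε : Function.Injective ε := by
    rw [← LinearMap.ker_eq_bot, LinearMap.ker_eq_bot']
    intro P hP
    apply Subtype.ext
    refine poly_eq_of_agree (C := C) (hdeg P) (by simp) (by omega) ?_
    intro x hx
    simpa [ε] using congrFun hP ⟨x, hx⟩
  have hle : LinearMap.range φ ≤ LinearMap.range ε := by
    rintro _ ⟨P, rfl⟩
    obtain ⟨P', hP', hev⟩ := hG P (by have := hdeg P; omega)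
    refine ⟨⟨P', mem_degreeLT.2 ?_⟩, ?_⟩
    · exact lt_of_le_of_lt degree_le_natDegree (by exact_mod_cast hP')
    · ext x
      simpa [φ, ε] using hev x x.2
  have heq : LinearMap.range φ = LinearMap.range ε := by
    refine Submodule.eq_of_le_of_finrank_eq hle ?_
    rw [LinearMap.finrank_range_of_inj hφ, LinearMap.finrank_range_of_inj hε]
  have hX : ε ⟨X, mem_degreeLT.2 (by rw [degree_X]; exact_mod_cast hs)⟩ ∈ LinearMap.range φ :=
    heq ▸ ⟨_, rfl⟩
  obtain ⟨P, hP⟩ := hX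
  intro x hx y hy hxy
  have h1 := congrFun hP ⟨x, hx⟩
  have h2 := congrFun hP ⟨y, hy⟩
  simp only [φ, ε, LinearMap.comp_apply, LinearMap.pi_apply, leval_apply,
    Submodule.subtype_apply, eval_X] at h1 h2
  rw [← h1, ← h2]
  exact congrArg (fun z => eval z (P : F[X])) hxy

/-- If `G` is not injective on `C`, its image is at most a third of `C`. -/
theorem SubstClosed.three_mul_card_image_le (hG : SubstClosed C s G) (hs : 2 ≤ s)
    (hr : s + 2 ≤ C.card) (hinj : ¬ Set.InjOn (fun x => G.eval x) C) :
    3 * (C.image fun x => G.eval x).card ≤ C.card := by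
  have hlt : (C.image fun x => G.eval x).card < s := by
    by_contra h
    exact hinj (hG.injOn hs (not_lt.1 h))
  refine Finset.mul_card_image_le_card (s := C) (f := fun x => G.eval x) 3 ?_
  intro y hy
  obtain ⟨x, hx, rfl⟩ := Finset.mem_image.1 hy
  set I := (C.image fun x => G.eval x).erase (G.eval x)
  have hIc : I.card < s := lt_of_le_of_lt (Finset.card_erase_le) hlt
  obtain ⟨P', hP', hev⟩ := hG (∏ z ∈ I, (X - Polynomial.C z))
    (by rw [natDegree_prod_X_sub_C_id]; exact hIc)
  by_contra hcon
  have hsplit := Finset.card_filter_add_card_filter_not (s := C) fun a => G.eval a = G.eval x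
  have hzero : P' = 0 := by
    refine poly_eq_of_agree (C := C.filter fun a => ¬ G.eval a = G.eval x) (m := s - 1)
      (by omega) (by simp) (by omega) ?_
    intro a ha
    obtain ⟨haC, hne⟩ := Finset.mem_filter.1 ha
    rw [hev a haC, eval_prod_X_sub_C_eq_zero, eval_zero]
    exact Finset.mem_erase.2 ⟨hne, Finset.mem_image_of_mem _ haC⟩
  have := hev x hx
  rw [hzero, eval_zero] at this
  exact eval_prod_X_sub_C_ne_zero (Finset.notMem_erase _ _) this.symm

/-- The factorisation identity for subsets of size `s - 1`. -/
theorem SubstClosed.exists_factor (hG : SubstClosed C s G) (hr : s + 2 ≤ C.card)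
    (hinj : Set.InjOn (fun x => G.eval x) C) {Z : Finset F} (hZ : Z ⊆ C)
    (hZc : Z.card + 1 = s) :
    ∃ κ : F, κ ≠ 0 ∧ ∀ x ∈ C,
      (∏ z ∈ Z, (G.eval x - G.eval z)) = κ * ∏ z ∈ Z, (x - z) := by
  have himg : (Z.image fun x => G.eval x).card = Z.card :=
    Finset.card_image_of_injOn (hinj.mono (by exact_mod_cast hZ))
  have hprod : ∀ x, (∏ z ∈ Z.image (fun x => G.eval x), (X - Polynomial.C z)).eval (G.eval x)
      = ∏ z ∈ Z, (G.eval x - G.eval z) := by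
    intro x
    rw [Finset.prod_image (hinj.mono (by exact_mod_cast hZ)), eval_prod]
    simp
  obtain ⟨P', hP', hev⟩ := hG (∏ z ∈ Z.image (fun x => G.eval x), (X - Polynomial.C z))
    (by rw [natDegree_prod_X_sub_C_id]; omega)
  obtain ⟨x₀, hx₀, hx₀Z⟩ := Finset.exists_mem_notMem_of_card_lt_card (s := Z) (t := C) (by omega)
  have hA : (∏ z ∈ Z, (x₀ - z)) ≠ 0 :=
    Finset.prod_ne_zero_iff.2 fun z hz => sub_ne_zero.2 fun h => hx₀Z (h ▸ hz)
  have hB : (∏ z ∈ Z, (G.eval x₀ - G.eval z)) ≠ 0 :=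
    Finset.prod_ne_zero_iff.2 fun z hz => sub_ne_zero.2 fun h =>
      hx₀Z (hinj hx₀ (hZ hz) h ▸ hz)
  refine ⟨(∏ z ∈ Z, (G.eval x₀ - G.eval z)) / ∏ z ∈ Z, (x₀ - z), div_ne_zero hB hA, ?_⟩
  have hpoly : P' = Polynomial.C ((∏ z ∈ Z, (G.eval x₀ - G.eval z)) / ∏ z ∈ Z, (x₀ - z)) *
      ∏ z ∈ Z, (X - Polynomial.C z) := by
    refine poly_eq_of_agree (C := insert x₀ Z) (m := s - 1) (by omega) ?_ ?_ ?_
    · refine (natDegree_C_mul_le _ _).trans ?_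
      rw [natDegree_prod_X_sub_C_id]; omega
    · rw [Finset.card_insert_of_notMem hx₀Z]; omega
    · intro x hx
      rcases Finset.mem_insert.1 hx with rfl | hx
      · rw [hev _ hx₀, hprod, eval_mul, eval_C, eval_prod]
        simp only [eval_sub, eval_X, eval_C]
        rw [div_mul_cancel₀ _ hA]
      · rw [hev _ (hZ hx), hprod, eval_mul, eval_prod_X_sub_C_eq_zero hx, mul_zero]
        exact Finset.prod_eq_zero hx (sub_self _)
  intro x hx
  rw [← hprod, ← hev x hx, hpoly, eval_mul, eval_C, eval_prod]
  simp

/-- `G` preserves cross-ratios of points of `C`. -/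
theorem SubstClosed.cross_ratio (hG : SubstClosed C s G) (hs : 2 ≤ s) (hr : s + 2 ≤ C.card)
    (hinj : Set.InjOn (fun x => G.eval x) C) {a b y z : F} (ha : a ∈ C) (hb : b ∈ C)
    (hy : y ∈ C) (hz : z ∈ C) :
    (G.eval a - G.eval y) * (G.eval b - G.eval z) * ((a - z) * (b - y)) =
      (G.eval a - G.eval z) * (G.eval b - G.eval y) * ((a - y) * (b - z)) := by
  have hcard : s - 2 ≤ (C \ {a, b, y, z}).card := by
    have h1 := Finset.le_card_sdiff ({a, b, y, z} : Finset F) C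
    have h2 : ({a, b, y, z} : Finset F).card ≤ 4 := Finset.card_le_four
    omega
  obtain ⟨Y, hY, hYc⟩ := Finset.exists_subset_card_eq hcard
  have hYC : Y ⊆ C := hY.trans Finset.sdiff_subset
  have hYn : ∀ u ∈ ({a, b, y, z} : Finset F), u ∉ Y := fun u hu huY =>
    (Finset.mem_sdiff.1 (hY huY)).2 hu
  have haY := hYn a (by simp)
  have hbY := hYn b (by simp)
  have hyY := hYn y (by simp)
  have hzY := hYn z (by simp)
  obtain ⟨κ, hκ, h1⟩ := hG.exists_factor hr hinj (Z := insert y Y)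
    (Finset.insert_subset hy hYC) (by rw [Finset.card_insert_of_notMem hyY]; omega)
  obtain ⟨μ, hμ, h2⟩ := hG.exists_factor hr hinj (Z := insert z Y)
    (Finset.insert_subset hz hYC) (by rw [Finset.card_insert_of_notMem hzY]; omega)
  have hne : ∀ x, x ∈ C → x ∉ Y → (∏ v ∈ Y, (G.eval x - G.eval v)) ≠ 0 ∧
      (∏ v ∈ Y, (x - v)) ≠ 0 := fun x hx hxY =>
    ⟨Finset.prod_ne_zero_iff.2 fun v hv => sub_ne_zero.2 fun h =>
      hxY (hinj hx (hYC hv) h ▸ hv),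
     Finset.prod_ne_zero_iff.2 fun v hv => sub_ne_zero.2 fun h => hxY (h ▸ hv)⟩
  have key : ∀ x, x ∈ C → x ∉ Y →
      μ * ((G.eval x - G.eval y) * (x - z)) = κ * ((G.eval x - G.eval z) * (x - y)) := by
    intro x hx hxY
    have e1 := h1 x hx
    have e2 := h2 x hx
    rw [Finset.prod_insert hyY, Finset.prod_insert hyY] at e1
    rw [Finset.prod_insert hzY, Finset.prod_insert hzY] at e2
    obtain ⟨n1, n2⟩ := hne x hx hxY
    refine mul_left_cancel₀ (mul_ne_zero n1 n2) ?_
    linear_combination (μ * (x - z) * ∏ v ∈ Y, (x - v)) * e1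
      - (κ * (x - y) * ∏ v ∈ Y, (x - v)) * e2
  have ka := key a ha haY
  have kb := key b hb hbY
  refine mul_left_cancel₀ (mul_ne_zero hμ hκ) ?_
  linear_combination (κ * (G.eval b - G.eval z) * (b - y)) * ka
    - (κ * (G.eval a - G.eval z) * (a - y)) * kb

/-- A substitution that is injective on `C` is affine. -/
theorem SubstClosed.natDegree_le_one (hG : SubstClosed C s G) (hs : 3 ≤ s)
    (hr : s + 2 ≤ C.card) (hdeg : G.natDegree < s)
    (hinj : Set.InjOn (fun x => G.eval x) C) : G.natDegree ≤ 1 := by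
  obtain ⟨b, y, z, hb, hy, hz, hby, hbz, hyz⟩ := Finset.two_lt_card_iff.1 (by omega : 2 < C.card)
  set A := (G.eval b - G.eval z) * (b - y) with hA
  set B := (G.eval b - G.eval y) * (b - z) with hB
  have hA0 : A ≠ 0 := mul_ne_zero (sub_ne_zero.2 fun h => hbz (hinj hb hz h)) (sub_ne_zero.2 hby)
  by_contra hlt
  have hpoly : Polynomial.C A * ((G - Polynomial.C (G.eval y)) * (X - Polynomial.C z)) =
      Polynomial.C B * ((G - Polynomial.C (G.eval z)) * (X - Polynomial.C y)) := by
    have hd : ∀ (a u v : F), (Polynomial.C a * ((G - Polynomial.C u) *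
        (X - Polynomial.C v))).natDegree ≤ s := by
      intro a u v
      refine (natDegree_C_mul_le _ _).trans (natDegree_mul_le.trans ?_)
      rw [natDegree_sub_C, natDegree_X_sub_C]; omega
    refine poly_eq_of_agree (C := C) (hd _ _ _) (hd _ _ _) (by omega) ?_
    intro a ha
    simp only [eval_mul, eval_C, eval_sub, eval_X]
    have := hG.cross_ratio (by omega) hr hinj ha hb hy hz
    rw [hA, hB]
    linear_combination this
  have hcoef : ∀ (a u v : F), (Polynomial.C a * ((G - Polynomial.C u) *
        (X - Polynomial.C v))).coeff (G.natDegree + 1) = a * G.leadingCoeff := by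
    intro a u v
    rw [coeff_C_mul]
    congr 1
    have h := coeff_mul_add_eq_of_natDegree_le (df := G.natDegree) (dg := 1)
      (f := G - Polynomial.C u) (g := X - Polynomial.C v)
      (by rw [natDegree_sub_C]) (by rw [natDegree_X_sub_C])
    rw [h, coeff_sub, coeff_sub, coeff_C, coeff_C, if_neg (by omega), coeff_X_one]
    simp
  have hAB : A = B := by
    have h := congrArg (fun P => coeff P (G.natDegree + 1)) hpoly
    simp only [hcoef] at h
    refine mul_right_cancel₀ (leadingCoeff_ne_zero.2 ?_) h
    rintro rfl
    simp at hlt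
  have haff : Polynomial.C (y - z) * G =
      Polynomial.C (G.eval y - G.eval z) * X + Polynomial.C (y * G.eval z - z * G.eval y) := by
    rw [← hAB] at hpoly
    have h := mul_left_cancel₀ (C_ne_zero.2 hA0) hpoly
    simp only [C_sub, C_mul]
    linear_combination h
  have hd := congrArg natDegree haff
  rw [natDegree_C_mul (sub_ne_zero.2 hyz)] at hd
  exact hlt (hd.trans_le natDegree_linear_le)

end Rigidity

section Orbit

variable {F : Type*} [Field F] [DecidableEq F] {C : Finset F} {s : ℕ}

theorem eval_of_natDegree_le_one {F : Type*} [Field F] {P : F[X]} (hP : P.natDegree ≤ 1) (x : F) :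
    P.eval x = P.coeff 1 * x + P.coeff 0 := by
  conv_lhs => rw [eq_X_add_C_of_natDegree_le_one hP]
  simp

/-- Iterating an affine map. -/
theorem iterate_affine {F : Type*} [Field F] {u : ℕ → F} {α β : F}
    (hu : ∀ b, u (b + 1) = α * u b + β) (b : ℕ) :
    u b = u 0 + (u 1 - u 0) * ∑ i ∈ Finset.range b, α ^ i := by
  induction b with
  | zero => simp
  | succ b ih =>
    rw [geom_sum_succ, hu b]
    have h0 := hu 0
    rw [zero_add] at h0
    linear_combination α * ih + (-1 : F) * h0

/-- Two commuting substitutions generating `C` from one point are affine. -/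
theorem natDegree_le_one_of_orbit {G G' : F[X]} (hs : 3 ≤ s) (hr : s + 2 ≤ C.card)
    {c : ℕ → ℕ → F} (hC : ∀ x, x ∈ C ↔ ∃ a b, c a b = x)
    (hcG : ∀ a b, c (a + 1) b = G.eval (c a b)) (hcG' : ∀ a b, c a (b + 1) = G'.eval (c a b))
    (hG : SubstClosed C s G) (hG' : SubstClosed C s G')
    (hdG : G.natDegree < s) (hdG' : G'.natDegree < s) : G.natDegree ≤ 1 := by
  by_cases hinj : Set.InjOn (fun x => G.eval x) C
  · exact hG.natDegree_le_one hs hr hdG hinj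
  have h3 := hG.three_mul_card_image_le (by omega) hr hinj
  have hmem : ∀ a b, c a b ∈ C := fun a b => (hC _).2 ⟨a, b, rfl⟩
  by_cases hinj' : Set.InjOn (fun x => G'.eval x) C
  swap
  · have h3' := hG'.three_mul_card_image_le (by omega) hr hinj'
    have hsub : C ⊆ insert (c 0 0) ((C.image fun x => G.eval x) ∪ C.image fun x => G'.eval x) := by
      intro x hx
      obtain ⟨a, b, rfl⟩ := (hC x).1 hx
      rcases a with _ | a
      · rcases b with _ | b
        · simp
        · refine Finset.mem_insert_of_mem (Finset.mem_union_right _ ?_)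
          exact Finset.mem_image.2 ⟨_, hmem 0 b, (hcG' 0 b).symm⟩
      · refine Finset.mem_insert_of_mem (Finset.mem_union_left _ ?_)
        exact Finset.mem_image.2 ⟨_, hmem a b, (hcG a b).symm⟩
    have h1 := Finset.card_le_card hsub
    have h2 := Finset.card_insert_le (c 0 0)
      ((C.image fun x => G.eval x) ∪ C.image fun x => G'.eval x)
    have h4 := Finset.card_union_le (C.image fun x => G.eval x) (C.image fun x => G'.eval x)
    omega
  have hd1 := hG'.natDegree_le_one hs hr hdG' hinj'
  set α := G'.coeff 1
  set β := G'.coeff 0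
  have haff : ∀ a b, c a (b + 1) = α * c a b + β := fun a b => by
    rw [hcG', eval_of_natDegree_le_one hd1]
  by_cases hfix : c 1 1 = c 1 0
  · have hrow : ∀ b, c 1 b = c 1 0 := fun b => by
      rw [iterate_affine (haff 1) b, hfix]; ring
    by_cases hid : α = 1
    · have hβ : β = 0 := by
        have := haff 1 0
        rw [zero_add, hfix, hid] at this
        linear_combination -this
      have hcol : ∀ a b, c a b = c a 0 := fun a b => by
        induction b with
        | zero => rfl
        | succ b ih => rw [haff, ih, hid, hβ]; ring
      have hsub : C ⊆ insert (c 0 0) (C.image fun x => G.eval x) := by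
        intro x hx
        obtain ⟨a, b, rfl⟩ := (hC x).1 hx
        rw [hcol a b]
        rcases a with _ | a
        · simp
        · refine Finset.mem_insert_of_mem ?_
          exact Finset.mem_image.2 ⟨_, hmem a 0, (hcG a 0).symm⟩
      have h1 := Finset.card_le_card hsub
      have h2 := Finset.card_insert_le (c 0 0) (C.image fun x => G.eval x)
      omega
    · have h20 : c 2 0 = c 1 0 := by
        have e1 : c 2 1 = c 2 0 := by rw [hcG 1 1, hcG 1 0, hfix]
        have e2 := haff 2 0
        have e3 := haff 1 0
        rw [zero_add, e1] at e2
        rw [zero_add, hfix] at e3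
        refine mul_left_cancel₀ (sub_ne_zero.2 hid) ?_
        linear_combination e3 - e2
      have hall : ∀ a b, c (a + 1) b = c 1 0 := fun a => by
        induction a with
        | zero => exact hrow
        | succ a ih => intro b; rw [hcG, ih b, ← hcG, h20]
      have hconst : G = Polynomial.C (c 1 0) := by
        refine poly_eq_of_agree (C := C) (m := s) hdG.le (by simp) (by omega) ?_
        intro x hx
        obtain ⟨a, b, rfl⟩ := (hC x).1 hx
        rw [← hcG, hall, eval_C]
      rw [hconst, natDegree_C]
      omega
  · exfalso
    classical
    set H₀ := C.filter fun x => ∃ b, c 0 b = x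
    have hinj0 : Set.InjOn (fun x => G.eval x) H₀ := by
      intro x hx y hy hxy
      obtain ⟨b, rfl⟩ := (Finset.mem_filter.1 hx).2
      obtain ⟨b', rfl⟩ := (Finset.mem_filter.1 hy).2
      simp only [← hcG, zero_add] at hxy
      rw [iterate_affine (haff 1) b, iterate_affine (haff 1) b'] at hxy
      have := mul_left_cancel₀ (sub_ne_zero.2 hfix) (add_left_cancel hxy)
      rw [iterate_affine (haff 0) b, iterate_affine (haff 0) b', this]
    have hsub : C ⊆ H₀ ∪ C.image fun x => G.eval x := by
      intro x hx
      obtain ⟨a, b, rfl⟩ := (hC x).1 hx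
      rcases a with _ | a
      · exact Finset.mem_union_left _ (Finset.mem_filter.2 ⟨hx, b, rfl⟩)
      · exact Finset.mem_union_right _ (Finset.mem_image.2 ⟨_, hmem a b, (hcG a b).symm⟩)
    have h1 := Finset.card_le_card hsub
    have h2 := Finset.card_union_le H₀ (C.image fun x => G.eval x)
    have h4 : H₀.card ≤ (C.image fun x => G.eval x).card := by
      rw [← Finset.card_image_of_injOn hinj0]
      exact Finset.card_le_card (Finset.image_subset_image (Finset.filter_subset _ _))
    omega

end Orbit

section Translation

variable {F : Type*} [Field F] [DecidableEq F] {C : Finset F} {s : ℕ}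

theorem coeff_sum_pow_mul_X_pow {F : Type*} [Field F] {G : F[X]} (hG : G.natDegree ≤ 1) (j : ℕ) :
    (∑ i ∈ Finset.range (j + 1), G ^ i * X ^ (j - i)).natDegree ≤ j ∧
    (∑ i ∈ Finset.range (j + 1), G ^ i * X ^ (j - i)).coeff j =
      ∑ i ∈ Finset.range (j + 1), G.coeff 1 ^ i := by
  have hpow : ∀ i, (G ^ i).natDegree ≤ i := fun i =>
    natDegree_pow_le.trans (by simpa using Nat.mul_le_mul_left i hG)
  constructor
  · refine natDegree_sum_le_of_forall_le _ _ fun i hi => ?_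
    refine natDegree_mul_le.trans ?_
    rw [natDegree_X_pow]
    have := hpow i
    have := Finset.mem_range.1 hi
    omega
  · rw [finsetSum_coeff]
    refine Finset.sum_congr rfl fun i hi => ?_
    have hij : j = i + (j - i) := by have := Finset.mem_range.1 hi; omega
    conv_lhs => rw [hij]
    rw [Nat.add_sub_cancel_left, coeff_mul_X_pow]
    simpa using coeff_pow_of_natDegree_le (m := i) hG

theorem coeff_eq_zero_of_quadratic {F : Type*} [Field F] {a b d : F}
    (h : Polynomial.C a * X ^ 2 + Polynomial.C b * X + Polynomial.C d = 0) : a = 0 ∧ b = 0 := by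
  have c2 := congrArg (fun P => coeff P 2) h
  have c1 := congrArg (fun P => coeff P 1) h
  simp only [coeff_add, coeff_C_mul, coeff_X_pow, coeff_X, coeff_C, coeff_zero] at c1 c2
  exact ⟨by simpa using c2, by simpa using c1⟩

theorem geom_sum_mod {F : Type*} [Field F] {α : F} {N : ℕ}
    (hN : ∑ i ∈ Finset.range N, α ^ i = 0) (a : ℕ) :
    ∑ i ∈ Finset.range a, α ^ i = ∑ i ∈ Finset.range (a % N), α ^ i := by
  have hpow : α ^ N = 1 := by
    have := geom_sum_mul α N
    rw [hN, zero_mul] at this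
    linear_combination -this
  have hstep : ∀ b, ∑ i ∈ Finset.range (b + N), α ^ i = ∑ i ∈ Finset.range b, α ^ i := by
    intro b
    rw [add_comm, Finset.sum_range_add, hN, zero_add]
    exact Finset.sum_congr rfl fun i _ => by rw [pow_add, hpow, one_mul]
  have hmul : ∀ m b, ∑ i ∈ Finset.range (b + N * m), α ^ i = ∑ i ∈ Finset.range b, α ^ i := by
    intro m
    induction m with
    | zero => intro b; simp
    | succ m ih => intro b; rw [Nat.mul_succ, ← add_assoc, hstep, ih]
  conv_lhs => rw [← Nat.mod_add_div a N]
  exact hmul _ _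

theorem geom_sum_eq_zero_of_substitution {F : Type*} [Field F] {C : Finset F} {s : ℕ}
    {H G h : F[X]} {j : ℕ} (hG : G.natDegree ≤ 1)
    (hr : s + 2 ≤ C.card) (hh : h.natDegree < s)
    (hev : ∀ x ∈ C, h.eval x = H.eval x *
      ∑ i ∈ Finset.range (j + 1), G.eval x ^ i * x ^ (j - i))
    (hl : s ≤ H.natDegree + j) (hu : H.natDegree + j ≤ s + 1) (hH : H ≠ 0) :
    ∑ i ∈ Finset.range (j + 1), G.coeff 1 ^ i = 0 := by
  obtain ⟨hd, hc⟩ := coeff_sum_pow_mul_X_pow hG j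
  have heq : h = H * ∑ i ∈ Finset.range (j + 1), G ^ i * X ^ (j - i) := by
    refine poly_eq_of_agree (C := C) (m := s + 1) (by omega) ?_ (by omega) ?_
    · exact natDegree_mul_le.trans (by omega)
    · intro x hx
      rw [hev x hx, eval_mul, eval_finsetSum]
      simp
  have hcoeff := congrArg (fun P => coeff P (H.natDegree + j)) heq
  rw [coeff_eq_zero_of_natDegree_lt (by omega), coeff_mul_add_eq_of_natDegree_le le_rfl hd,
    hc] at hcoeff
  exact (mul_eq_zero.1 hcoeff.symm).resolve_left (leadingCoeff_ne_zero.2 hH)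

/-- The translation part of a substitution operator is affine. -/
theorem natDegree_translation_le_one {G G' H : F[X]} {h : ℕ → F[X]} (hs : 3 ≤ s)
    (hr : s + 2 ≤ C.card)
    {c : ℕ → ℕ → F} (hC : ∀ x, x ∈ C ↔ ∃ a b, c a b = x)
    (hcG : ∀ a b, c (a + 1) b = G.eval (c a b)) (hcG' : ∀ a b, c a (b + 1) = G'.eval (c a b))
    (hG : G.natDegree ≤ 1) (hG' : G'.natDegree ≤ 1) (hH : H.natDegree < s)
    (hh : ∀ j, j + 1 < s → (h (j + 1)).natDegree < s)
    (hev : ∀ j, j + 1 < s → ∀ x ∈ C, (h (j + 1)).eval x = H.eval x *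
      ∑ i ∈ Finset.range (j + 1), G.eval x ^ i * x ^ (j - i))
    (hcomm : ∀ x ∈ C, H.eval (G'.eval x) = G'.coeff 1 * H.eval x) : H.natDegree ≤ 1 := by
  by_contra hlt
  have hH0 : H ≠ 0 := by rintro rfl; simp at hlt
  have haffG : ∀ a b, c (a + 1) b = G.coeff 1 * c a b + G.coeff 0 := fun a b => by
    rw [hcG, eval_of_natDegree_le_one hG]
  have haffG' : ∀ a b, c a (b + 1) = G'.coeff 1 * c a b + G'.coeff 0 := fun a b => by
    rw [hcG', eval_of_natDegree_le_one hG']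
  set α := G.coeff 1
  set β := G.coeff 0
  set α' := G'.coeff 1
  set β' := G'.coeff 0
  have hg : ∀ j, j + 1 < s → s ≤ H.natDegree + j → H.natDegree + j ≤ s + 1 →
      ∑ i ∈ Finset.range (j + 1), α ^ i = 0 := fun j hj hl hu =>
    geom_sum_eq_zero_of_substitution hG hr (hh j hj) (hev j hj) hl hu hH0
  have h0 := hg (s - H.natDegree) (by omega) (by omega) (by omega)
  have hdeg : H.natDegree = 2 := by
    by_contra h2
    have h1 := hg (s - H.natDegree + 1) (by omega) (by omega) (by omega)
    rw [geom_sum_succ, h0] at h1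
    simp at h1
  have horb : ∀ b, (Finset.image (fun a => c a b) (Finset.range (s - 1))).card ≤ s - 1 ∧
      ∀ a, c a b ∈ Finset.image (fun a => c a b) (Finset.range (s - 1)) := by
    intro b
    refine ⟨Finset.card_image_le.trans (by simp), fun a => ?_⟩
    refine Finset.mem_image.2 ⟨a % (s - 1), Finset.mem_range.2 (Nat.mod_lt _ (by omega)), ?_⟩
    rw [hdeg, show s - 2 + 1 = s - 1 by omega] at h0
    rw [iterate_affine (u := fun a => c a b) (fun a => haffG a b) a,
      iterate_affine (u := fun a => c a b) (fun a => haffG a b) (a % (s - 1)), ← geom_sum_mod h0]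
  have hHev : ∀ x, H.eval x = H.coeff 2 * x ^ 2 + H.coeff 1 * x + H.coeff 0 := by
    intro x
    rw [eval_eq_sum_range, hdeg, Finset.sum_range_succ, Finset.sum_range_succ,
      Finset.sum_range_one]
    ring
  have hη : H.coeff 2 ≠ 0 := by
    have := leadingCoeff_ne_zero.2 hH0
    rwa [leadingCoeff, hdeg] at this
  have hpoly : Polynomial.C (H.coeff 2 * (α' ^ 2 - α')) * X ^ 2 +
      Polynomial.C (2 * H.coeff 2 * α' * β') * X +
      Polynomial.C (H.coeff 2 * β' ^ 2 + H.coeff 1 * β' + H.coeff 0 - α' * H.coeff 0) = 0 := by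
    refine poly_eq_of_agree (C := C) (m := 2) natDegree_quadratic_le (by simp) (by omega) ?_
    intro x hx
    have := hcomm x hx
    rw [hHev, hHev, eval_of_natDegree_le_one hG'] at this
    simp only [eval_add, eval_mul, eval_C, eval_pow, eval_X, eval_zero]
    linear_combination this
  obtain ⟨c2, c1⟩ := coeff_eq_zero_of_quadratic hpoly
  have c2 := (mul_eq_zero.1 c2).resolve_left hη
  have hα' : α' = 0 ∨ α' = 1 := by
    have : α' * (α' - 1) = 0 := by linear_combination c2
    rcases mul_eq_zero.1 this with h | h
    · exact Or.inl h
    · exact Or.inr (by linear_combination h)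
  obtain ⟨hcard0, hmem0⟩ := horb 0
  rcases hα' with h0' | h1'
  · have hsub : C ⊆ insert β' (Finset.image (fun a => c a 0) (Finset.range (s - 1))) := by
      intro x hx
      obtain ⟨a, b, rfl⟩ := (hC x).1 hx
      rcases b with _ | b
      · exact Finset.mem_insert_of_mem (hmem0 a)
      · rw [haffG', h0']; simp
    have h1 := Finset.card_le_card hsub
    have h2 := Finset.card_insert_le β' (Finset.image (fun a => c a 0) (Finset.range (s - 1)))
    omega
  by_cases hβ' : β' = 0
  · have hcol : ∀ a b, c a b = c a 0 := fun a b => by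
      induction b with
      | zero => rfl
      | succ b ih => rw [haffG', ih, h1', hβ']; ring
    have hsub : C ⊆ Finset.image (fun a => c a 0) (Finset.range (s - 1)) := by
      intro x hx
      obtain ⟨a, b, rfl⟩ := (hC x).1 hx
      rw [hcol a b]
      exact hmem0 a
    have h1 := Finset.card_le_card hsub
    omega
  · have h2 : (2 : F) = 0 := by
      rw [h1', mul_one] at c1
      have := (mul_eq_zero.1 c1).resolve_right hβ'
      exact (mul_eq_zero.1 this).resolve_right hη
    have hα1 : α = 1 := by
      have e1 := haffG 0 1
      have e2 := haffG' 1 0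
      have e3 := haffG 0 0
      have e4 := haffG' 0 0
      simp only [zero_add, h1', one_mul] at e1 e2 e3 e4
      refine mul_right_cancel₀ hβ' ?_
      linear_combination e2 - e1 + e3 - α * e4
    have hform : ∀ a b, c a b = c 0 0 + (a : F) * β + (b : F) * β' := by
      intro a b
      induction a with
      | zero =>
        induction b with
        | zero => simp
        | succ b ih => rw [haffG', ih, h1']; push_cast; ring
      | succ a ih => rw [haffG, ih, hα1]; push_cast; ring
    have hbit : ∀ a : ℕ, (a : F) = 0 ∨ (a : F) = 1 := by
      intro a
      have : (a : F) = ((a % 2 : ℕ) : F) := by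
        conv_lhs => rw [← Nat.mod_add_div a 2]
        push_cast
        rw [h2]; ring
      rw [this]
      rcases Nat.mod_two_eq_zero_or_one a with h | h <;> simp [h]
    have hsub : C ⊆ {c 0 0, c 0 0 + β, c 0 0 + β', c 0 0 + β + β'} := by
      intro x hx
      obtain ⟨a, b, rfl⟩ := (hC x).1 hx
      rw [hform a b]
      rcases hbit a with ha | ha <;> rcases hbit b with hb | hb <;> simp [ha, hb]
    have h1 := Finset.card_le_card hsub
    have h3 := Finset.card_le_four (a := c 0 0) (b := c 0 0 + β) (c := c 0 0 + β')
      (d := c 0 0 + β + β')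
    omega

end Translation

end Polynomial

section Triangular

variable {F : Type} [Field F]

/-- The exponent of `X^a Y^b`. -/
def expo (a b : ℕ) : Fin 2 →₀ ℕ := Finsupp.single 0 a + Finsupp.single 1 b

@[simp] theorem expo_zero (a b : ℕ) : expo a b 0 = a := by simp [expo]

@[simp] theorem expo_one (a b : ℕ) : expo a b 1 = b := by simp [expo]

theorem expo_eq (m : Fin 2 →₀ ℕ) : expo (m 0) (m 1) = m := by
  ext i
  fin_cases i <;> simp

theorem expo_le_iff {m m' : Fin 2 →₀ ℕ} : m ≤ m' ↔ m 0 ≤ m' 0 ∧ m 1 ≤ m' 1 := by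
  rw [Finsupp.le_def]
  exact Fin.forall_fin_two

theorem monomial_expo (a b : ℕ) :
    (X 0 ^ a * X 1 ^ b : MvPolynomial (Fin 2) F) = monomial (expo a b) 1 := by
  rw [X_pow_eq_monomial, X_pow_eq_monomial, monomial_mul, one_mul]
  rfl

/-- The diagonal entry of `G` at the exponent `m`. -/
def diagAt (G : Module.End F (MvPolynomial (Fin 2) F)) (m : Fin 2 →₀ ℕ) : F :=
  coeff m (G (monomial m 1))

theorem diagEntry_eq_diagAt (G : Module.End F (MvPolynomial (Fin 2) F)) (a b : ℕ) :
    diagEntry F G a b = diagAt G (expo a b) := by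
  rw [diagEntry, diagAt, monomial_expo]
  rfl

/-- The polynomials `p` with `deg_X p < t` and `deg_Y p < k`. -/
def box (F : Type) [Field F] (t k : ℕ) : Submodule F (MvPolynomial (Fin 2) F) :=
  restrictSupport F {m | m 0 < t ∧ m 1 < k}

theorem mem_box {t k : ℕ} {p : MvPolynomial (Fin 2) F} : p ∈ box F t k ↔ DegLT F t k p :=
  Iff.rfl

theorem mem_box_iff_coeff {t k : ℕ} {p : MvPolynomial (Fin 2) F} :
    p ∈ box F t k ↔ ∀ m, coeff m p ≠ 0 → m 0 < t ∧ m 1 < k := by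
  rw [mem_box, DegLT]
  simp only [mem_support_iff]

theorem mem_box_iff_degreeOf {t k : ℕ} {p : MvPolynomial (Fin 2) F} (hp : p ≠ 0) :
    p ∈ box F t k ↔ p.degreeOf 0 < t ∧ p.degreeOf 1 < k := by
  obtain ⟨m, hm⟩ := support_nonempty.2 hp
  constructor
  · intro h
    have h0 : 0 < t := (Nat.zero_le _).trans_lt (h hm).1
    have h1 : 0 < k := (Nat.zero_le _).trans_lt (h hm).2
    exact ⟨(degreeOf_lt_iff h0).2 fun m hm => (h hm).1, (degreeOf_lt_iff h1).2 fun m hm => (h hm).2⟩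
  · rintro ⟨h0, h1⟩ m hm
    exact ⟨(monomial_le_degreeOf 0 hm).trans_lt h0, (monomial_le_degreeOf 1 hm).trans_lt h1⟩

/-- The basis of `box F t k` is indexed by the exponents. -/
def boxExpEquiv (t k : ℕ) : Fin t × Fin k ≃ {m : Fin 2 →₀ ℕ | m 0 < t ∧ m 1 < k} where
  toFun ab := ⟨expo ab.1 ab.2, by simp⟩
  invFun m := (⟨m.1 0, m.2.1⟩, ⟨m.1 1, m.2.2⟩)
  left_inv ab := by simp
  right_inv m := Subtype.ext (expo_eq m.1)

def boxBasis (F : Type) [Field F] (t k : ℕ) : Module.Basis (Fin t × Fin k) F (box F t k) :=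
  (basisRestrictSupport F _).reindex (boxExpEquiv t k).symm

instance (t k : ℕ) : Module.Finite F (box F t k) := Module.Finite.of_basis (boxBasis F t k)

theorem finrank_box (t k : ℕ) : Module.finrank F (box F t k) = t * k := by
  rw [Module.finrank_eq_card_basis (boxBasis F t k)]
  simp

theorem mul_mem_box {t k t' k' : ℕ} {p p' : MvPolynomial (Fin 2) F} (hp : p ∈ box F (t + 1) (k + 1))
    (hp' : p' ∈ box F t' k') : p * p' ∈ box F (t + t') (k + k') := by
  classical
  intro m hm
  obtain ⟨m₁, h₁, m₂, h₂, rfl⟩ := Finset.mem_add.1 (support_mul p p' hm)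
  have a := hp h₁
  have b := hp' h₂
  simp only [Set.mem_ofPred_eq, Finsupp.add_apply] at a b ⊢
  omega

/-- `L` is degree-preserving in both variables. -/
def DegPres (L : Module.End F (MvPolynomial (Fin 2) F)) : Prop :=
  ∀ p : MvPolynomial (Fin 2) F, p ≠ 0 →
    L p ≠ 0 ∧ (L p).degreeOf 0 = p.degreeOf 0 ∧ (L p).degreeOf 1 = p.degreeOf 1

variable {L : Module.End F (MvPolynomial (Fin 2) F)}

theorem DegPres.map_mem_box (hL : DegPres L) {t k : ℕ} {p : MvPolynomial (Fin 2) F}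
    (hp : p ∈ box F t k) : L p ∈ box F t k := by
  by_cases h0 : p = 0
  · simp [h0]
  · obtain ⟨h1, h2, h3⟩ := hL p h0
    rw [mem_box_iff_degreeOf h1, h2, h3]
    exact (mem_box_iff_degreeOf h0).1 hp

theorem DegPres.pow_mem_box (hL : DegPres L) {t k : ℕ} {p : MvPolynomial (Fin 2) F}
    (hp : p ∈ box F t k) (i : ℕ) : (L ^ i) p ∈ box F t k := by
  induction i with
  | zero => simpa
  | succ i ih => rw [pow_succ', Module.End.mul_apply]; exact hL.map_mem_box ih

theorem DegPres.le_of_coeff_ne_zero (hL : DegPres L) {m m' : Fin 2 →₀ ℕ}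
    (h : coeff m (L (monomial m' 1)) ≠ 0) : m ≤ m' := by
  have hm : monomial m' (1 : F) ∈ box F (m' 0 + 1) (m' 1 + 1) := by
    rw [mem_box_iff_coeff]
    intro u hu
    rw [coeff_monomial] at hu
    have : m' = u := by by_contra hne; simp [hne] at hu
    subst this
    simp
  have := mem_box_iff_coeff.1 (hL.map_mem_box hm) m h
  exact expo_le_iff.2 ⟨by omega, by omega⟩

/-- The lexicographic order on bivariate exponents. -/
abbrev bivLex : MonomialOrder (Fin 2) := MonomialOrder.lex

theorem DegPres.coeff_map (hL : DegPres L) {p : MvPolynomial (Fin 2) F} {m : Fin 2 →₀ ℕ}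
    (hp : ∀ m', coeff m' p ≠ 0 → bivLex.toSyn m' ≤ bivLex.toSyn m) :
    coeff m (L p) = coeff m p * diagAt L m := by
  conv_lhs => rw [p.as_sum, map_sum, coeff_sum]
  have hterm : ∀ m' ∈ p.support, m' ≠ m → coeff m (L (monomial m' (coeff m' p))) = 0 := by
    intro m' hm' hne
    have hs : monomial m' (coeff m' p) = coeff m' p • monomial m' (1 : F) := by
      rw [smul_monomial, smul_eq_mul, mul_one]
    rw [hs, map_smul, coeff_smul, smul_eq_mul]
    by_contra h0
    have hle := hL.le_of_coeff_ne_zero (right_ne_zero_of_mul h0)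
    have h1 := bivLex.toSyn_monotone hle
    have h2 := hp m' (mem_support_iff.1 hm')
    exact hne (bivLex.toSyn.injective (le_antisymm h2 h1))
  have hs : monomial m (coeff m p) = coeff m p • monomial m (1 : F) := by
    rw [smul_monomial, smul_eq_mul, mul_one]
  rw [Finset.sum_eq_single m hterm, hs, map_smul, coeff_smul, smul_eq_mul, diagAt]
  intro h
  rw [notMem_support_iff.1 h]
  simp

theorem DegPres.lex_le_map (hL : DegPres L) {p : MvPolynomial (Fin 2) F} {m : Fin 2 →₀ ℕ}
    (hp : ∀ m', coeff m' p ≠ 0 → bivLex.toSyn m' ≤ bivLex.toSyn m) (m' : Fin 2 →₀ ℕ)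
    (hm' : coeff m' (L p) ≠ 0) : bivLex.toSyn m' ≤ bivLex.toSyn m := by
  rw [p.as_sum, map_sum, coeff_sum] at hm'
  obtain ⟨u, hu, hne⟩ := Finset.exists_ne_zero_of_sum_ne_zero hm'
  have hs : monomial u (coeff u p) = coeff u p • monomial u (1 : F) := by
    rw [smul_monomial, smul_eq_mul, mul_one]
  rw [hs, map_smul, coeff_smul, smul_eq_mul] at hne
  have hle := hL.le_of_coeff_ne_zero (right_ne_zero_of_mul hne)
  exact (bivLex.toSyn_monotone hle).trans (hp u (mem_support_iff.1 hu))

theorem DegPres.coeff_pow (hL : DegPres L) {p : MvPolynomial (Fin 2) F} {m : Fin 2 →₀ ℕ}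
    (hp : ∀ m', coeff m' p ≠ 0 → bivLex.toSyn m' ≤ bivLex.toSyn m) (i : ℕ) :
    coeff m ((L ^ i) p) = coeff m p * diagAt L m ^ i ∧
      ∀ m', coeff m' ((L ^ i) p) ≠ 0 → bivLex.toSyn m' ≤ bivLex.toSyn m := by
  induction i with
  | zero => simpa using hp
  | succ i ih =>
    rw [pow_succ' L, Module.End.mul_apply]
    refine ⟨?_, hL.lex_le_map ih.2⟩
    rw [hL.coeff_map ih.2, ih.1]
    ring

theorem DegPres.diagAt_pow (hL : DegPres L) (m : Fin 2 →₀ ℕ) (j : ℕ) :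
    diagAt (L ^ j) m = diagAt L m ^ j := by
  classical
  rw [diagAt, (hL.coeff_pow (m := m) _ j).1, coeff_monomial, if_pos rfl, one_mul]
  intro m' h
  rw [coeff_monomial] at h
  have : m = m' := by by_contra hne; simp [hne] at h
  rw [this]

/-- Every diagonal value is an eigenvalue. -/
theorem DegPres.exists_eigenvector (hL : DegPres L) (m : Fin 2 →₀ ℕ) :
    ∃ v : MvPolynomial (Fin 2) F, v ≠ 0 ∧ L v = C (diagAt L m) * v := by
  classical
  set B := box F (m 0 + 1) (m 1 + 1)
  have hmB : monomial m (1 : F) ∈ B := by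
    rw [mem_box_iff_coeff]
    intro u hu
    rw [coeff_monomial] at hu
    have : m = u := by by_contra hne; simp [hne] at hu
    subst this
    simp
  have hmaps : ∀ p ∈ B, (L - diagAt L m • 1) p ∈ B := fun p hp => by
    rw [LinearMap.sub_apply, LinearMap.smul_apply, Module.End.one_apply]
    exact B.sub_mem (hL.map_mem_box hp) (B.smul_mem _ hp)
  let N : B →ₗ[F] B := (L - diagAt L m • 1).restrict hmaps
  have hnot : ¬ Function.Surjective N := by
    intro hsurj
    obtain ⟨p, hp⟩ := hsurj ⟨_, hmB⟩
    have hp' : L p - diagAt L m • (p : MvPolynomial (Fin 2) F) = monomial m 1 :=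
      congrArg Subtype.val hp
    have hc := congrArg (coeff m) hp'
    rw [coeff_sub, coeff_smul, hL.coeff_map, coeff_monomial, if_pos rfl, smul_eq_mul, mul_comm,
      sub_self] at hc
    · exact zero_ne_one hc
    · intro m' hm'
      have := mem_box_iff_coeff.1 p.2 m' hm'
      exact bivLex.toSyn_monotone (expo_le_iff.2 ⟨by omega, by omega⟩)
  rw [← LinearMap.injective_iff_surjective, ← LinearMap.ker_eq_bot] at hnot
  obtain ⟨v, hv, hv0⟩ := Submodule.exists_mem_ne_zero_of_ne_bot hnot
  refine ⟨v, fun h => hv0 (Subtype.ext h), ?_⟩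
  have : L v - diagAt L m • (v : MvPolynomial (Fin 2) F) = 0 := congrArg Subtype.val hv
  rw [sub_eq_zero.1 this, smul_eq_C_mul]

theorem DegPres.diagAt_ne_zero (hL : DegPres L) (m : Fin 2 →₀ ℕ) : diagAt L m ≠ 0 := by
  intro h
  obtain ⟨v, hv, hLv⟩ := hL.exists_eigenvector m
  rw [h, C_0, zero_mul] at hLv
  exact (hL v hv).1 hLv

end Triangular

section Directional

variable {F : Type} [Field F] {L : Module.End F (MvPolynomial (Fin 2) F)} {C₀ : Finset F} {s : ℕ}

/-- The polynomials `g j`, `h j` describe the action of `L ^ j` on multiples of the variable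
`X δ`: on an eigenvector `v` with eigenvalue `x`, the product `X δ * v` is mapped to
`(g j x * X δ + h j x) * v`. -/
structure DirectionalData (L : Module.End F (MvPolynomial (Fin 2) F)) (C₀ : Finset F) (s : ℕ)
    (δ : Fin 2) (g h : ℕ → Polynomial F) : Prop where
  natDegree_g : ∀ j, (g j).natDegree < s
  natDegree_h : ∀ j, (h j).natDegree < s
  map_X_mul : ∀ p, L (X δ * p) =
    ∑ m ∈ Finset.range s, (C ((g 1).coeff m) * X δ + C ((h 1).coeff m)) * (L ^ m) p
  map_eigenvector : ∀ j < s, ∀ x ∈ C₀, ∀ v, v ≠ 0 → L v = C x * v →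
    (L ^ j) (X δ * v) = (C ((g j).eval x) * X δ + C ((h j).eval x)) * v

theorem map_C_mul (T : Module.End F (MvPolynomial (Fin 2) F)) (x : F)
    (v : MvPolynomial (Fin 2) F) : T (C x * v) = C x * T v := by
  rw [← smul_eq_C_mul, map_smul, smul_eq_C_mul]

theorem pow_eigenvector {x : F} {v : MvPolynomial (Fin 2) F} (hv : L v = C x * v) (m : ℕ) :
    (L ^ m) v = C (x ^ m) * v := by
  induction m with
  | zero => simp
  | succ m ih =>
    rw [pow_succ' L, Module.End.mul_apply, ih, map_C_mul, hv, pow_succ, C_mul, mul_assoc]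

theorem DegPres.pow_preserves (hL : DegPres L) (j : ℕ) : DegPres (L ^ j) := by
  induction j with
  | zero => intro p hp; simpa using hp
  | succ j ih =>
    intro p hp
    obtain ⟨h1, h2, h3⟩ := ih p hp
    obtain ⟨k1, k2, k3⟩ := hL _ h1
    rw [pow_succ' L, Module.End.mul_apply]
    exact ⟨k1, k2.trans h2, k3.trans h3⟩

theorem degreeOf_X_fin_two (δ i : Fin 2) :
    degreeOf i (X δ : MvPolynomial (Fin 2) F) = if i = δ then 1 else 0 := by
  rw [degreeOf_X]

/-- A polynomial of degree one in `X δ` and of degree zero in the other variable. -/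
theorem exponent_of_degreeOf_le {δ : Fin 2} {K : MvPolynomial (Fin 2) F}
    (h : ∀ i, degreeOf i K ≤ if i = δ then 1 else 0) {e : Fin 2 →₀ ℕ} (he : coeff e K ≠ 0) :
    e = 0 ∨ e = Finsupp.single δ 1 := by
  have hle : ∀ i, e i ≤ if i = δ then 1 else 0 := fun i =>
    (monomial_le_degreeOf i (mem_support_iff.2 he)).trans (h i)
  by_cases h0 : e δ = 0
  · left
    ext i
    by_cases hi : i = δ
    · simpa [hi] using h0
    · simpa [hi] using hle i
  · right
    ext i
    by_cases hi : i = δ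
    · subst hi
      have := hle i
      simp only [if_true] at this
      rw [Finsupp.single_eq_same]
      omega
    · rw [Finsupp.single_eq_of_ne hi]
      simpa [hi] using hle i

theorem exists_directionalData [DecidableEq F] (hL : DegPres L) (hs : 2 ≤ s)
    (hcard : s ≤ C₀.card) (hC : ∀ x, x ∈ C₀ → ∃ m, diagAt L m = x) {δ : Fin 2}
    {M : Matrix (Fin s) (Fin s) (MvPolynomial (Fin 2) F)}
    (hM : ∀ p, (fun i : Fin s => (L ^ (i : ℕ)) (X δ * p)) =
      M.mulVec fun i => (L ^ (i : ℕ)) p) :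
    ∃ g h, DirectionalData L C₀ s δ g h := by
  classical
  have hM' : ∀ (j : Fin s) p, (L ^ (j : ℕ)) (X δ * p) = ∑ m, M j m * (L ^ (m : ℕ)) p := fun j p =>
    congrFun (hM p) j
  let N : Fin s → (Fin 2 →₀ ℕ) → Polynomial F := fun j e =>
    ∑ m : Fin s, Polynomial.monomial (m : ℕ) (coeff e (M j m))
  have hNdeg : ∀ j e, (N j e).natDegree ≤ s - 1 := fun j e =>
    Polynomial.natDegree_sum_le_of_forall_le _ _ fun m _ =>
      (Polynomial.natDegree_monomial_le _).trans (by omega)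
  have hNcoeff : ∀ j e (m : Fin s), (N j e).coeff m = coeff e (M j m) := fun j e m => by
    simp only [N, Polynomial.finsetSum_coeff, Polynomial.coeff_monomial, Fin.val_inj]
    simp
  have hNeval : ∀ j e x, (N j e).eval x = coeff e (∑ m, M j m * C (x ^ (m : ℕ))) := fun j e x => by
    simp only [N, Polynomial.eval_finsetSum, Polynomial.eval_monomial, coeff_sum]
    exact Finset.sum_congr rfl fun m _ => by rw [mul_comm (M j m), coeff_C_mul, mul_comm]
  have hact : ∀ (j : Fin s) x v, L v = C x * v →
      (L ^ (j : ℕ)) (X δ * v) = (∑ m, M j m * C (x ^ (m : ℕ))) * v := fun j x v hv => by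
    rw [hM', Finset.sum_mul]
    refine Finset.sum_congr rfl fun m _ => ?_
    rw [pow_eigenvector hv, mul_assoc]
  have hdeg : ∀ (j : Fin s) x v, v ≠ 0 → L v = C x * v → ∀ i,
      degreeOf i (∑ m, M j m * C (x ^ (m : ℕ))) ≤ if i = δ then 1 else 0 := by
    intro j x v hv0 hv i
    have hXv : X δ * v ≠ 0 := mul_ne_zero (X_ne_zero δ) hv0
    have hP := hL.pow_preserves j _ hXv
    have hK := hact j x v hv
    have hK0 : (∑ m, M j m * C (x ^ (m : ℕ))) ≠ 0 := by
      intro h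
      rw [h, zero_mul] at hK
      exact hP.1 hK
    have hi : degreeOf i ((L ^ (j : ℕ)) (X δ * v)) = degreeOf i (X δ * v) := by
      fin_cases i
      · exact hP.2.1
      · exact hP.2.2
    rw [hK, degreeOf_mul_eq hK0 hv0, degreeOf_mul_eq (X_ne_zero δ) hv0, degreeOf_X_fin_two] at hi
    omega
  have hNzero : ∀ j e, e ≠ 0 → e ≠ Finsupp.single δ 1 → N j e = 0 := by
    intro j e he0 he1
    refine Polynomial.poly_eq_of_agree (C := C₀) (hNdeg j e) (by simp) (by omega) ?_
    intro x hx
    obtain ⟨m, rfl⟩ := hC x hx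
    obtain ⟨v, hv0, hv⟩ := hL.exists_eigenvector m
    rw [hNeval, Polynomial.eval_zero]
    by_contra hne
    rcases exponent_of_degreeOf_le (hdeg j _ v hv0 hv) hne with h | h
    · exact he0 h
    · exact he1 h
  have hsingle : (Finsupp.single δ 1 : Fin 2 →₀ ℕ) ≠ 0 := by
    simp
  have haffine : ∀ K : MvPolynomial (Fin 2) F,
      (∀ e, e ≠ 0 → e ≠ Finsupp.single δ 1 → coeff e K = 0) →
      K = C (coeff (Finsupp.single δ 1) K) * X δ + C (coeff 0 K) := by
    intro K hK
    ext e
    rw [coeff_add, coeff_C_mul, coeff_X, coeff_C]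
    by_cases h0 : e = 0
    · subst h0
      simp [hsingle]
    · by_cases h1 : e = Finsupp.single δ 1
      · subst h1
        simp [hsingle.symm]
      · rw [hK e h0 h1, if_neg (Ne.symm h1), if_neg (Ne.symm h0)]
        simp
  refine ⟨fun j => if hj : j < s then N ⟨j, hj⟩ (Finsupp.single δ 1) else 0,
    fun j => if hj : j < s then N ⟨j, hj⟩ 0 else 0, ⟨?_, ?_, ?_, ?_⟩⟩
  · intro j
    by_cases hj : j < s
    · simp only [hj, dif_pos]
      have := hNdeg ⟨j, hj⟩ (Finsupp.single δ 1)
      omega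
    · simp only [hj, dif_neg, not_false_eq_true, Polynomial.natDegree_zero]
      omega
  · intro j
    by_cases hj : j < s
    · simp only [hj, dif_pos]
      have := hNdeg ⟨j, hj⟩ 0
      omega
    · simp only [hj, dif_neg, not_false_eq_true, Polynomial.natDegree_zero]
      omega
  · intro p
    have h1 : 1 < s := by omega
    simp only [h1, dif_pos]
    have := hM' ⟨1, h1⟩ p
    rw [pow_one] at this
    rw [this, Finset.sum_range]
    refine Finset.sum_congr rfl fun m _ => ?_
    rw [hNcoeff, hNcoeff]
    congr 1
    refine haffine _ fun e h0 h1 => ?_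
    rw [← hNcoeff, hNzero _ e h0 h1, Polynomial.coeff_zero]
  · intro j hj x hx v hv0 hv
    simp only [hj, dif_pos]
    rw [hact ⟨j, hj⟩ x v hv, hNeval, hNeval]
    congr 1
    refine haffine _ fun e h0 h1 => ?_
    rw [← hNeval, hNzero _ e h0 h1, Polynomial.eval_zero]

theorem affine_coeffs {δ : Fin 2} {a b a' b' : F} {v : MvPolynomial (Fin 2) F} (hv : v ≠ 0)
    (h : (C a * X δ + C b) * v = (C a' * X δ + C b') * v) : a = a' ∧ b = b' := by
  classical
  have h := mul_right_cancel₀ hv h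
  have h0 := congrArg (coeff 0) h
  have h1 := congrArg (coeff (Finsupp.single δ 1)) h
  have hsingle : (0 : Fin 2 →₀ ℕ) ≠ Finsupp.single δ 1 := by
    rw [ne_comm]; simp
  simp only [coeff_add, coeff_C_mul, coeff_X, coeff_C, if_neg hsingle, if_neg hsingle.symm] at h0 h1
  exact ⟨by simpa using h1, by simpa using h0⟩

variable {δ : Fin 2} {g h : ℕ → Polynomial F}

theorem DirectionalData.eval_recursion (hD : DirectionalData L C₀ s δ g h) (hL : DegPres L)
    (hC : ∀ x, x ∈ C₀ → ∃ m, diagAt L m = x) {x : F} (hx : x ∈ C₀) (hs : 2 ≤ s) :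
    (g 0).eval x = 1 ∧ (h 0).eval x = 0 ∧ ∀ j, j + 1 < s →
      (g (j + 1)).eval x = (g j).eval x * (g 1).eval x ∧
      (h (j + 1)).eval x = (g j).eval x * (h 1).eval x + x * (h j).eval x := by
  obtain ⟨m, rfl⟩ := hC x hx
  obtain ⟨v, hv0, hv⟩ := hL.exists_eigenvector m
  have hact := fun j hj => hD.map_eigenvector j hj _ hx v hv0 hv
  have h1 := hact 1 (by omega)
  rw [pow_one] at h1
  have h0 : (C ((g 0).eval (diagAt L m)) * X δ + C ((h 0).eval (diagAt L m))) * v =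
      (C 1 * X δ + C 0) * v := by
    rw [← hact 0 (by omega)]
    simp
  obtain ⟨e1, e2⟩ := affine_coeffs hv0 h0
  refine ⟨e1, e2, fun j hj => ?_⟩
  have hstep := hact (j + 1) hj
  rw [pow_succ' L, Module.End.mul_apply, hact j (by omega), add_mul, mul_assoc, map_add, map_C_mul,
    map_C_mul, h1, hv] at hstep
  refine affine_coeffs hv0 (hstep.symm.trans ?_)
  simp only [C_add, C_mul]
  ring

theorem DirectionalData.eval_g (hD : DirectionalData L C₀ s δ g h) (hL : DegPres L)
    (hC : ∀ x, x ∈ C₀ → ∃ m, diagAt L m = x) {x : F} (hx : x ∈ C₀) (hs : 2 ≤ s) {j : ℕ}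
    (hj : j < s) : (g j).eval x = (g 1).eval x ^ j := by
  obtain ⟨h0, -, hrec⟩ := hD.eval_recursion hL hC hx hs
  induction j with
  | zero => simpa using h0
  | succ j ih => rw [(hrec j hj).1, ih (by omega), pow_succ]

theorem DirectionalData.eval_h (hD : DirectionalData L C₀ s δ g h) (hL : DegPres L)
    (hC : ∀ x, x ∈ C₀ → ∃ m, diagAt L m = x) {x : F} (hx : x ∈ C₀) (hs : 2 ≤ s) {j : ℕ}
    (hj : j + 1 < s) : (h (j + 1)).eval x =
      (h 1).eval x * ∑ i ∈ Finset.range (j + 1), (g 1).eval x ^ i * x ^ (j - i) := by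
  obtain ⟨-, -, hrec⟩ := hD.eval_recursion hL hC hx hs
  induction j with
  | zero => simp
  | succ j ih =>
    rw [(hrec (j + 1) hj).2, ih (by omega), hD.eval_g hL hC hx hs (by omega),
      Finset.sum_range_succ _ (j + 1), Nat.sub_self, pow_zero, mul_one, mul_add, add_comm]
    congr 1
    · rw [mul_left_comm, Finset.mul_sum]
      congr 1
      refine Finset.sum_congr rfl fun i hi => ?_
      rw [Nat.succ_sub (by have := Finset.mem_range.1 hi; omega), pow_succ]
      ring
    · ring

theorem DirectionalData.substClosed (hD : DirectionalData L C₀ s δ g h) (hL : DegPres L)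
    (hC : ∀ x, x ∈ C₀ → ∃ m, diagAt L m = x) (hs : 2 ≤ s) :
    Polynomial.SubstClosed C₀ s (g 1) := by
  intro P hP
  refine ⟨∑ j ∈ Finset.range s, Polynomial.C (P.coeff j) * g j, ?_, ?_⟩
  · refine lt_of_le_of_lt (Polynomial.natDegree_sum_le_of_forall_le (n := s - 1) _ _ ?_) (by omega)
    intro j _
    have := hD.natDegree_g j
    exact (Polynomial.natDegree_C_mul_le _ _).trans (by omega)
  · intro x hx
    rw [Polynomial.eval_finsetSum, Polynomial.eval_eq_sum_range' hP]
    refine Finset.sum_congr rfl fun j hj => ?_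
    rw [Polynomial.eval_mul, Polynomial.eval_C, hD.eval_g hL hC hx hs (Finset.mem_range.1 hj)]

theorem DirectionalData.diagAt_add (hD : DirectionalData L C₀ s δ g h) (hL : DegPres L)
    (m : Fin 2 →₀ ℕ) :
    diagAt L (m + Finsupp.single δ 1) = (g 1).eval (diagAt L m) := by
  classical
  have hmono : monomial (m + Finsupp.single δ 1) (1 : F) = X δ * monomial m 1 := by
    rw [X, monomial_mul, one_mul, add_comm]
  have hle : ∀ m', coeff m' (monomial m (1 : F)) ≠ 0 → bivLex.toSyn m' ≤ bivLex.toSyn m := by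
    intro m' h
    rw [coeff_monomial] at h
    have : m = m' := by by_contra hne; simp [hne] at h
    rw [this]
  rw [diagAt, hmono, hD.map_X_mul, coeff_sum, Polynomial.eval_eq_sum_range' (hD.natDegree_g 1)]
  refine Finset.sum_congr rfl fun i _ => ?_
  obtain ⟨h1, h2⟩ := hL.coeff_pow hle i
  have hz : coeff (m + Finsupp.single δ 1) ((L ^ i) (monomial m 1)) = 0 := by
    by_contra hne
    have h3 := h2 _ hne
    have h4 : bivLex.toSyn m ≤ bivLex.toSyn (m + Finsupp.single δ 1) :=
      bivLex.toSyn_monotone (by simp)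
    have h5 := bivLex.toSyn.injective (le_antisymm h3 h4)
    simp at h5
  rw [add_mul, coeff_add, coeff_C_mul, hz, mul_zero, add_zero, mul_assoc, coeff_C_mul,
    mul_comm (X δ), coeff_mul_X, h1, coeff_monomial, if_pos rfl, one_mul]

theorem eval_h_of_commute {δ' : Fin 2} (hne : δ ≠ δ') {g' h' : ℕ → Polynomial F}
    (hD : DirectionalData L C₀ s δ g h) (hD' : DirectionalData L C₀ s δ' g' h') (hL : DegPres L)
    (hC : ∀ x, x ∈ C₀ → ∃ m, diagAt L m = x) (hs : 2 ≤ s) {x : F} (hx : x ∈ C₀)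
    (hg' : (g' 1).natDegree ≤ 1) :
    (h 1).eval ((g' 1).eval x) = (g' 1).coeff 1 * (h 1).eval x := by
  classical
  have hrec := hD.eval_recursion hL hC hx hs
  have hgev := fun j hj => hD'.eval_g hL hC hx hs (j := j) hj
  obtain ⟨m, hm⟩ := hC x hx
  obtain ⟨v, hv0, hv⟩ := hL.exists_eigenvector m
  rw [hm] at hv
  have e1 := hD.map_X_mul (X δ' * v)
  have e2 := hD'.map_X_mul (X δ * v)
  rw [mul_left_comm, e2] at e1
  have e3 : (∑ m ∈ Finset.range s, (C ((g' 1).coeff m) * X δ' + C ((h' 1).coeff m)) *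
      (C ((g m).eval x) * X δ + C ((h m).eval x))) * v =
      (∑ m ∈ Finset.range s, (C ((g 1).coeff m) * X δ + C ((h 1).coeff m)) *
      (C ((g' m).eval x) * X δ' + C ((h' m).eval x))) * v := by
    rw [Finset.sum_mul, Finset.sum_mul]
    refine Eq.trans (Finset.sum_congr rfl fun i hi => ?_) (e1.trans
      (Finset.sum_congr rfl fun i hi => ?_))
    · rw [hD.map_eigenvector i (Finset.mem_range.1 hi) x hx v hv0 hv, mul_assoc]
    · rw [hD'.map_eigenvector i (Finset.mem_range.1 hi) x hx v hv0 hv, mul_assoc]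
  have e4 := congrArg (coeff (Finsupp.single δ' 1)) (mul_right_cancel₀ hv0 e3)
  have hs1 : (0 : Fin 2 →₀ ℕ) ≠ Finsupp.single δ' 1 := by rw [ne_comm]; simp
  have hprod : ∀ a b a' b' : F, coeff (Finsupp.single δ' 1)
      ((C a * X δ + C b) * (C a' * X δ' + C b') : MvPolynomial (Fin 2) F) = b * a' := by
    intro a b a' b'
    have : ((C a * X δ + C b) * (C a' * X δ' + C b') : MvPolynomial (Fin 2) F) =
        C (a * a') * (X δ * X δ') + C (a * b') * X δ + C (b * a') * X δ' + C (b * b') := by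
      simp only [C_mul]; ring
    rw [this]
    simp only [coeff_add, coeff_C_mul, coeff_X, coeff_C, if_neg hs1, coeff_mul_X']
    simp [hne]
  rw [coeff_sum, coeff_sum, Finset.sum_congr rfl fun i _ => by rw [mul_comm, hprod],
    Finset.sum_congr rfl fun i _ => hprod _ _ _ _] at e4
  rw [Polynomial.eval_eq_sum_range' (hD.natDegree_h 1)]
  have e5 : ∑ i ∈ Finset.range s, (h 1).coeff i * (g' 1).eval x ^ i =
      ∑ i ∈ Finset.range s, (h 1).coeff i * (g' i).eval x :=
    Finset.sum_congr rfl fun i hi => by rw [hgev i (Finset.mem_range.1 hi)]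
  rw [e5, ← e4]
  obtain ⟨r, rfl⟩ : ∃ r, s = r + 2 := ⟨s - 2, by omega⟩
  rw [Finset.sum_range_succ', Finset.sum_range_succ', hrec.2.1, zero_mul, add_zero, zero_add,
    Finset.sum_eq_zero, zero_add, mul_comm]
  intro i _
  rw [Polynomial.coeff_eq_zero_of_natDegree_lt (n := i + 1 + 1) (by omega), mul_zero]

theorem DirectionalData.map_X_mul_affine (hD : DirectionalData L C₀ s δ g h) (hs : 2 ≤ s)
    (hg : (g 1).natDegree ≤ 1) (hh : (h 1).natDegree ≤ 1) :
    ∃ A B, ∀ p, L (X δ * p) = A * L p + B * p := by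
  refine ⟨C ((g 1).coeff 1) * X δ + C ((h 1).coeff 1),
    C ((g 1).coeff 0) * X δ + C ((h 1).coeff 0), fun p => ?_⟩
  rw [hD.map_X_mul]
  obtain ⟨r, rfl⟩ : ∃ r, s = r + 2 := ⟨s - 2, by omega⟩
  rw [Finset.sum_range_succ', Finset.sum_range_succ', Finset.sum_eq_zero]
  · simp
  intro i _
  rw [Polynomial.coeff_eq_zero_of_natDegree_lt (n := i + 1 + 1) (p := g 1) (by omega),
    Polynomial.coeff_eq_zero_of_natDegree_lt (n := i + 1 + 1) (p := h 1) (by omega)]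
  simp

/-- If `L` has at least `s + 2` eigenvalues, then `L (X p)` and `L (Y p)` are combinations of
`L p` and `p`. -/
theorem exists_affine_of_card [DecidableEq F] (hL : DegPres L) (hs : 3 ≤ s)
    (hcard : s + 2 ≤ C₀.card) (hC : ∀ x, x ∈ C₀ ↔ ∃ a b, diagAt L (expo a b) = x)
    {Mx My : Matrix (Fin s) (Fin s) (MvPolynomial (Fin 2) F)}
    (hext : LinExt F s (fun i : Fin s => L ^ (i : ℕ)) Mx My) (δ : Fin 2) :
    ∃ A B, ∀ p, L (X δ * p) = A * L p + B * p := by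
  have hC' : ∀ x, x ∈ C₀ → ∃ m, diagAt L m = x := fun x hx => by
    obtain ⟨a, b, hab⟩ := (hC x).1 hx
    exact ⟨_, hab⟩
  obtain ⟨g, h, hD⟩ := exists_directionalData hL (by omega) (by omega) hC' hext.1
  obtain ⟨g', h', hD'⟩ := exists_directionalData hL (by omega) (by omega) hC' hext.2
  have hc : ∀ a b, diagAt L (expo (a + 1) b) = (g 1).eval (diagAt L (expo a b)) := fun a b => by
    rw [← hD.diagAt_add hL]
    congr 1
    rw [expo, expo, Finsupp.single_add, add_right_comm]
  have hc' : ∀ a b, diagAt L (expo a (b + 1)) = (g' 1).eval (diagAt L (expo a b)) := fun a b => by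
    rw [← hD'.diagAt_add hL]
    congr 1
    rw [expo, expo, Finsupp.single_add, add_assoc]
  have hCswap : ∀ x, x ∈ C₀ ↔ ∃ b a, diagAt L (expo a b) = x := fun x => by
    rw [hC x, exists_comm]
  have hS := hD.substClosed hL hC' (by omega)
  have hS' := hD'.substClosed hL hC' (by omega)
  have hg := Polynomial.natDegree_le_one_of_orbit hs hcard hC hc hc' hS hS'
    (hD.natDegree_g 1) (hD'.natDegree_g 1)
  have hg' := Polynomial.natDegree_le_one_of_orbit (c := fun b a => diagAt L (expo a b)) hs hcard
    hCswap (fun b a => hc' a b) (fun b a => hc a b) hS' hS (hD'.natDegree_g 1) (hD.natDegree_g 1)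
  have hh := Polynomial.natDegree_translation_le_one (h := h) hs hcard hC hc hc' hg hg'
    (hD.natDegree_h 1) (fun j _ => hD.natDegree_h _)
    (fun j hj x hx => hD.eval_h hL hC' hx (by omega) hj)
    (fun x hx => eval_h_of_commute (by decide) hD hD' hL hC' (by omega) hx hg')
  have hh' := Polynomial.natDegree_translation_le_one (h := h')
    (c := fun b a => diagAt L (expo a b)) hs hcard
    hCswap (fun b a => hc' a b) (fun b a => hc a b) hg' hg
    (hD'.natDegree_h 1) (fun j _ => hD'.natDegree_h _)
    (fun j hj x hx => hD'.eval_h hL hC' hx (by omega) hj)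
    (fun x hx => eval_h_of_commute (by decide) hD' hD hL hC' (by omega) hx hg)
  fin_cases δ
  · exact hD.map_X_mul_affine (by omega) hg hh
  · exact hD'.map_X_mul_affine (by omega) hg' hh'

end Directional

section Interpolation

variable {F : Type} [Field F] {L : Module.End F (MvPolynomial (Fin 2) F)}

/-- The operators `p ↦ L ^ j (Q * L ^ i p)` with `i < w` and `j ≤ s - w` are
`F[X,Y]`-combinations of `L ^ 0, …, L ^ (s - 1)`. -/
def CombClosed (L : Module.End F (MvPolynomial (Fin 2) F)) (s w : ℕ) : Prop :=
  ∀ i < w, ∀ j < s - w + 1, ∀ Q : MvPolynomial (Fin 2) F, ∃ θ : Fin s → MvPolynomial (Fin 2) F,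
    ∀ p, (L ^ j) (Q * (L ^ i) p) = ∑ m, θ m * (L ^ (m : ℕ)) p

theorem combClosed_self (s : ℕ) : CombClosed L s s := by
  intro i hi j hj Q
  obtain rfl : j = 0 := by omega
  refine ⟨fun m => if (m : ℕ) = i then Q else 0, fun p => ?_⟩
  rw [Finset.sum_eq_single ⟨i, hi⟩]
  · simp
  · intro m _ hm
    have : (m : ℕ) ≠ i := fun h => hm (Fin.ext h)
    simp [this]
  · simp

theorem combClosed_of_affine {s w : ℕ} (hw : w ≤ s)
    (h : ∀ δ : Fin 2, ∃ A B, ∀ p, L (X δ * p) = A * L p + B * p) : CombClosed L s w := by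
  have hQ : ∀ Q : MvPolynomial (Fin 2) F, ∃ A B, ∀ p, L (Q * p) = A * L p + B * p := by
    intro Q
    induction Q using MvPolynomial.induction_on with
    | C a => exact ⟨C a, 0, fun p => by rw [map_C_mul]; simp⟩
    | add Q₁ Q₂ h₁ h₂ =>
      obtain ⟨A₁, B₁, h₁⟩ := h₁
      obtain ⟨A₂, B₂, h₂⟩ := h₂
      refine ⟨A₁ + A₂, B₁ + B₂, fun p => ?_⟩
      rw [add_mul, map_add, h₁, h₂]
      ring
    | mul_X Q δ hQ =>
      obtain ⟨A₁, B₁, h₁⟩ := hQ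
      obtain ⟨A₂, B₂, h₂⟩ := h δ
      refine ⟨A₁ * A₂, A₁ * B₂ + B₁ * X δ, fun p => ?_⟩
      rw [mul_assoc, h₁, h₂]
      ring
  let V : ℕ → Submodule (MvPolynomial (Fin 2) F)
      (MvPolynomial (Fin 2) F → MvPolynomial (Fin 2) F) := fun r =>
    Submodule.span _ (Set.range fun m : Fin r => ((L ^ (m : ℕ) : Module.End F _) : _ → _))
  have hmono : ∀ {r r'}, r ≤ r' → V r ≤ V r' := fun {r r'} hr => by
    refine Submodule.span_mono ?_
    rintro _ ⟨m, rfl⟩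
    exact ⟨Fin.castLE hr m, rfl⟩
  have hstep : ∀ r, ∀ T ∈ V r, (fun p => L (T p)) ∈ V (r + 1) := by
    intro r T hT
    induction hT using Submodule.span_induction with
    | mem T hT =>
      obtain ⟨m, rfl⟩ := hT
      refine Submodule.subset_span ⟨m.succ, ?_⟩
      funext p
      simp only [Fin.val_succ]
      rw [pow_succ' L, Module.End.mul_apply]
    | zero =>
      convert (V (r + 1)).zero_mem using 1
      funext p
      simp
    | add T₁ T₂ _ _ h₁ h₂ =>
      convert (V (r + 1)).add_mem h₁ h₂ using 1
      funext p
      simp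
    | smul Q T hT hT' =>
      obtain ⟨A, B, hAB⟩ := hQ Q
      convert (V (r + 1)).add_mem ((V (r + 1)).smul_mem A hT')
        ((V (r + 1)).smul_mem B (hmono (Nat.le_succ r) hT)) using 1
      funext p
      simp [hAB]
  intro i hi j hj Q
  have hmem : ∀ j, (fun p => (L ^ j) (Q * (L ^ i) p)) ∈ V (i + 1 + j) := by
    intro j
    induction j with
    | zero =>
      convert (V (i + 1)).smul_mem Q (Submodule.subset_span ⟨Fin.last i, rfl⟩) using 1
      funext p
      simp
    | succ j ih =>
      have heq : (fun p => (L ^ (j + 1)) (Q * (L ^ i) p)) =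
          fun p => L ((L ^ j) (Q * (L ^ i) p)) := by
        funext p
        rw [pow_succ' L, Module.End.mul_apply]
      rw [heq]
      exact hstep _ _ ih
  have hs := hmono (show i + 1 + j ≤ s by omega) (hmem j)
  obtain ⟨θ, hθ⟩ := (Submodule.mem_span_range_iff_exists_fun _).1 hs
  refine ⟨θ, fun p => ?_⟩
  have := congrFun hθ p
  simpa using this.symm

theorem exists_linear_combination {s i j : ℕ}
    (h : ∀ Q : MvPolynomial (Fin 2) F, ∃ θ : Fin s → MvPolynomial (Fin 2) F,
      ∀ p, (L ^ j) (Q * (L ^ i) p) = ∑ m, θ m * (L ^ (m : ℕ)) p) :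
    ∃ Θ : MvPolynomial (Fin 2) F →ₗ[F] (Fin s → MvPolynomial (Fin 2) F),
      ∀ Q p, (L ^ j) (Q * (L ^ i) p) = ∑ m, Θ Q m * (L ^ (m : ℕ)) p := by
  choose θ hθ using fun e : Fin 2 →₀ ℕ => h (monomial e 1)
  let Θ := (basisMonomials (Fin 2) F).constr F θ
  refine ⟨Θ, fun Q p => ?_⟩
  have hlin : (L ^ j) ∘ₗ LinearMap.mulRight F ((L ^ i) p) =
      ∑ m : Fin s, LinearMap.mulRight F ((L ^ (m : ℕ)) p) ∘ₗ LinearMap.proj m ∘ₗ Θ := by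
    refine (basisMonomials (Fin 2) F).ext fun e => ?_
    have : Θ (basisMonomials (Fin 2) F e) = θ e := Module.Basis.constr_basis _ _ _ _
    simp only [LinearMap.comp_apply, LinearMap.sum_apply, LinearMap.mulRight_apply,
      LinearMap.proj_apply, this]
    rw [coe_basisMonomials]
    exact hθ e p
  have := LinearMap.congr_fun hlin Q
  simpa only [LinearMap.comp_apply, LinearMap.sum_apply, LinearMap.mulRight_apply,
    LinearMap.proj_apply] using this

/-- The leading exponent of a nonzero solution of `∑ Q i * L ^ i p = 0`. -/
theorem exists_leading_relation (hL : DegPres L) {s w : ℕ} (hws : w ≤ s)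
    {Q : Fin w → MvPolynomial (Fin 2) F} (hQ : Q ≠ 0) :
    ∃ u : Fin s → F, u ≠ 0 ∧ ∀ p, p ≠ 0 → ∑ i, Q i * (L ^ (i : ℕ)) p = 0 →
      ∑ j, u j * diagAt L (bivLex.degree p) ^ (j : ℕ) = 0 := by
  classical
  obtain ⟨i₀, hi₀⟩ := Function.ne_iff.1 hQ
  obtain ⟨e₀, he₀⟩ := support_nonempty.2 hi₀
  obtain ⟨e, he, hmax⟩ := Finset.exists_max_image (Finset.univ.biUnion fun i => (Q i).support)
    (fun e => bivLex.toSyn e) ⟨e₀, Finset.mem_biUnion.2 ⟨i₀, Finset.mem_univ _, he₀⟩⟩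
  obtain ⟨i₁, -, hi₁⟩ := Finset.mem_biUnion.1 he
  refine ⟨fun j => if hj : (j : ℕ) < w then coeff e (Q ⟨j, hj⟩) else 0, ?_, ?_⟩
  · intro h
    have := congrFun h ⟨i₁, i₁.2.trans_le hws⟩
    simp only [i₁.2, dif_pos, Fin.eta, Pi.zero_apply] at this
    exact mem_support_iff.1 hi₁ this
  · intro p hp hsum
    set m := bivLex.degree p
    have hlc : coeff m p ≠ 0 := bivLex.leadingCoeff_ne_zero_iff.2 hp
    have hp' : ∀ m', coeff m' p ≠ 0 → bivLex.toSyn m' ≤ bivLex.toSyn m := fun m' hm' =>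
      bivLex.le_degree (mem_support_iff.2 hm')
    have hc := congrArg (coeff (e + m)) hsum
    rw [coeff_sum, coeff_zero] at hc
    have hterm : ∀ i : Fin w, coeff (e + m) (Q i * (L ^ (i : ℕ)) p) =
        coeff m p * (coeff e (Q i) * diagAt L m ^ (i : ℕ)) := by
      intro i
      obtain ⟨h1, h2⟩ := hL.coeff_pow hp' i
      rw [MonomialOrder.coeff_mul_of_add_of_degree_le (m := bivLex), h1]
      · ring
      · exact MonomialOrder.degree_le_iff.2 fun e' he' =>
          hmax e' (Finset.mem_biUnion.2 ⟨i, Finset.mem_univ _, he'⟩)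
      · exact MonomialOrder.degree_le_iff.2 fun m' hm' => h2 m' (mem_support_iff.1 hm')
    rw [Finset.sum_congr rfl fun i _ => hterm i, ← Finset.mul_sum] at hc
    have hc' := (mul_eq_zero.1 hc).resolve_left hlc
    refine Eq.trans ?_ hc'
    obtain ⟨r, rfl⟩ := Nat.exists_eq_add_of_le hws
    rw [Fin.sum_univ_add, Finset.sum_eq_zero (s := (Finset.univ : Finset (Fin r))), add_zero]
    · refine Finset.sum_congr rfl fun i _ => ?_
      beta_reduce
      rw [dif_pos (show ((Fin.castAdd r i : Fin (w + r)) : ℕ) < w from i.2)]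
      rfl
    · intro i _
      beta_reduce
      rw [dif_neg (by simp), zero_mul]

theorem card_le_of_leading_relation [Fintype F] (hL : DegPres L) {s w t k ℓ : ℕ} (hws : w ≤ s)
    {Q : Fin w → MvPolynomial (Fin 2) F} (hQ : Q ≠ 0)
    (hdiag : ∀ u : Fin s → F, u ≠ 0 →
      {ab : Fin t × Fin k |
        (∑ j, u j * diagEntry F (L ^ (j : ℕ)) ab.1 ab.2) = 0}.ncard ≤ ℓ)
    {S : Set (MvPolynomial (Fin 2) F)} (hS : ∀ p ∈ S, p ∈ box F t k)
    (hzero : ∀ p ∈ S, ∑ i, Q i * (L ^ (i : ℕ)) p = 0) :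
    S.ncard ≤ Fintype.card F ^ ℓ := by
  classical
  obtain ⟨u, hu, hlead⟩ := exists_leading_relation hL hws hQ
  set Z := {ab : Fin t × Fin k | (∑ j, u j * diagEntry F (L ^ (j : ℕ)) ab.1 ab.2) = 0} with hZ
  let f : S → (Z → F) := fun p ab => coeff (expo ab.1.1 ab.1.2) (p : MvPolynomial (Fin 2) F)
  have hf : Function.Injective f := by
    intro p p' hpp
    apply Subtype.ext
    by_contra hne
    set d := (p : MvPolynomial (Fin 2) F) - p' with hd
    have hd0 : d ≠ 0 := sub_ne_zero.2 hne
    have hdQ : ∑ i, Q i * (L ^ (i : ℕ)) d = 0 := by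
      simp only [hd, map_sub, mul_sub, Finset.sum_sub_distrib]
      rw [hzero p p.2, hzero p' p'.2, sub_zero]
    have hdbox : d ∈ box F t k := (box F t k).sub_mem (hS p p.2) (hS p' p'.2)
    have hlc : coeff (bivLex.degree d) d ≠ 0 := bivLex.leadingCoeff_ne_zero_iff.2 hd0
    have hlt := mem_box_iff_coeff.1 hdbox _ hlc
    set m := bivLex.degree d
    have hmem : ((⟨m 0, hlt.1⟩, ⟨m 1, hlt.2⟩) : Fin t × Fin k) ∈ Z := by
      change _ = _
      simp only [diagEntry_eq_diagAt, expo_eq, hL.diagAt_pow]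
      exact hlead d hd0 hdQ
    have := congrFun hpp ⟨_, hmem⟩
    simp only [f, expo_eq] at this
    rw [hd, coeff_sub, sub_ne_zero] at hlc
    exact hlc this
  have hcard : Nat.card S ≤ Nat.card (Z → F) := Nat.card_le_card_of_injective f hf
  rw [Nat.card_coe_set_eq, Nat.card_fun, Nat.card_coe_set_eq, Nat.card_eq_fintype_card] at hcard
  exact hcard.trans (Nat.pow_le_pow_right Fintype.card_pos (hdiag u hu))

/-- Evaluation at a point of the plane. -/
abbrev evalAt (x : F × F) : MvPolynomial (Fin 2) F →+* F := eval ![x.1, x.2]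

theorem evalAt_smul (x : F × F) (a : F) (p : MvPolynomial (Fin 2) F) :
    evalAt x (a • p) = a * evalAt x p := by
  rw [smul_eq_C_mul, map_mul, evalAt, eval_C]

theorem exists_interpolation {s n w s' d₁ d₂ : ℕ}
    (Θ : Fin w → Fin s' → MvPolynomial (Fin 2) F →ₗ[F] (Fin s → MvPolynomial (Fin 2) F))
    (A : Fin n → F × F) (c : Fin n → Fin s → F) (hcount : n * s' < w * d₁ * d₂) :
    ∃ Q : Fin w → MvPolynomial (Fin 2) F, Q ≠ 0 ∧ (∀ i, Q i ∈ box F d₁ d₂) ∧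
      ∀ x j, ∑ i, ∑ m, evalAt (A x) (Θ i j (Q i) m) * c x m = 0 := by
  let ev : Fin n → MvPolynomial (Fin 2) F →ₗ[F] F := fun x =>
    { toFun := evalAt (A x)
      map_add' := map_add _
      map_smul' := fun a p => by rw [evalAt_smul]; rfl }
  let Φ : (Fin w → box F d₁ d₂) →ₗ[F] (Fin n × Fin s' → F) :=
    LinearMap.pi fun xj => ∑ i, ∑ m, (c xj.1 m) •
      (ev xj.1 ∘ₗ LinearMap.proj m ∘ₗ Θ i xj.2 ∘ₗ (box F d₁ d₂).subtype ∘ₗ LinearMap.proj i)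
  have hlt : Module.finrank F (Fin n × Fin s' → F) <
      Module.finrank F (Fin w → box F d₁ d₂) := by
    rw [Module.finrank_pi, Module.finrank_pi_fintype]
    simp only [finrank_box, Finset.sum_const, Finset.card_univ, Fintype.card_prod, Fintype.card_fin,
      smul_eq_mul]
    rwa [← mul_assoc]
  obtain ⟨Q, hQ, hQ0⟩ := Submodule.exists_mem_ne_zero_of_ne_bot
    (LinearMap.ker_ne_bot_of_finrank_lt (f := Φ) hlt)
  refine ⟨fun i => Q i, fun h => hQ0 ?_, fun i => (Q i).2, fun x j => ?_⟩
  · funext i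
    exact Subtype.ext (congrFun h i)
  · have := congrFun (LinearMap.mem_ker.1 hQ) (x, j)
    simp only [Φ, LinearMap.pi_apply, LinearMap.sum_apply, LinearMap.smul_apply,
      LinearMap.comp_apply, LinearMap.proj_apply, Submodule.subtype_apply, Pi.zero_apply,
      smul_eq_mul] at this
    rw [← this]
    refine Finset.sum_congr rfl fun i _ => Finset.sum_congr rfl fun m _ => ?_
    rw [mul_comm]
    rfl

/-- The list bound when the family is closed under combinations. -/
theorem list_bound_of_combClosed [Fintype F] (hL : DegPres L) {s n t k w d1 d2 D ℓ : ℕ}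
    (hcomb : CombClosed L s w) (A : Fin n → F × F) (hws : w ≤ s) (hd1 : t ≤ d1) (hd2 : k ≤ d2)
    (hcount : n * (s - w + 1) < w * (d1 - t + 1) * (d2 - k + 1))
    (hdist : ∀ R : MvPolynomial (Fin 2) F, R ≠ 0 → DegLT F d1 d2 R →
      D ≤ {i : Fin n |
        (fun j : Fin (s - w + 1) =>
          eval ![(A i).1, (A i).2] ((L ^ (j : ℕ)) R)) ≠ 0}.ncard)
    (hdiag : ∀ u : Fin s → F, u ≠ 0 →
      {ab : Fin t × Fin k |
        (∑ j, u j * diagEntry F (L ^ (j : ℕ)) ab.1 ab.2) = 0}.ncard ≤ ℓ)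
    (c : Fin n → Fin s → F) :
    {p : MvPolynomial (Fin 2) F | DegLT F t k p ∧
      {i : Fin n |
        (fun j : Fin s => eval ![(A i).1, (A i).2] ((L ^ (j : ℕ)) p)) ≠ c i}.ncard
        < D}.ncard ≤ Fintype.card F ^ ℓ := by
  choose Θ hΘ using fun (i : Fin w) (j : Fin (s - w + 1)) =>
    exists_linear_combination (hcomb i i.2 j j.2)
  obtain ⟨Q, hQ0, hQbox, hQ⟩ := exists_interpolation Θ A c hcount
  refine card_le_of_leading_relation hL hws hQ0 hdiag (fun p hp => hp.1) ?_
  rintro p ⟨hpbox, hpD⟩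
  by_contra hR
  set R := ∑ i, Q i * (L ^ (i : ℕ)) p with hRdef
  have hRbox : R ∈ box F d1 d2 := by
    refine Submodule.sum_mem _ fun i _ => ?_
    have := mul_mem_box (hQbox i) (hL.pow_mem_box (mem_box.2 hpbox) i)
    rwa [Nat.sub_add_cancel hd1, Nat.sub_add_cancel hd2] at this
  refine absurd ((hdist R hR hRbox).trans (Set.ncard_le_ncard ?_ (Set.toFinite _))) (not_le.2 hpD)
  intro x hx hagree
  refine hx (funext fun j => ?_)
  have hexp : (L ^ (j : ℕ)) R = ∑ i, ∑ m, Θ i j (Q i) m * (L ^ (m : ℕ)) p := by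
    rw [hRdef, map_sum]
    exact Finset.sum_congr rfl fun i _ => hΘ i j (Q i) p
  rw [hexp, Pi.zero_apply, ← hQ x j, map_sum]
  refine Finset.sum_congr rfl fun i _ => ?_
  rw [map_sum]
  refine Finset.sum_congr rfl fun m _ => ?_
  rw [map_mul, ← hagree]

end Interpolation

section Averaging

variable {F U M ι : Type} [Field F] [Fintype F] [AddCommGroup U] [Module F U] [Fintype U]
  [AddCommGroup M] [Module F M] [Fintype ι]

open Classical in
theorem card_nonzero_add_one (W : Submodule F U) :
    (Finset.univ.filter fun p : U => p ∈ W ∧ p ≠ 0).card + 1 =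
      Fintype.card F ^ Module.finrank F W := by
  have h1 : Fintype.card W = Fintype.card F ^ Module.finrank F W := Module.card_eq_pow_finrank
  have h2 : (Finset.univ.filter fun p : U => p ∈ W).card = Fintype.card W :=
    (Fintype.card_subtype _).symm
  have h3 : (Finset.univ.filter fun p : U => p ∈ W ∧ p ≠ 0) =
      (Finset.univ.filter fun p : U => p ∈ W).erase 0 := by
    ext p
    simp [and_comm]
  rw [← h1, ← h2, h3, Finset.card_erase_add_one]
  simp

open Classical in
/-- Averaging the number of zeros over the nonzero elements of `W`. -/
theorem average_zeros (e : ι → U →ₗ[F] M) (W : Submodule F U) (hW : 2 ≤ Module.finrank F W) {a : ℝ}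
    (ha : ∀ p ∈ W, p ≠ 0 → ((Finset.univ.filter fun i => e i p = 0).card : ℝ) ≤ a) :
    ((Finset.univ.filter fun i => W ≤ LinearMap.ker (e i)).card : ℝ) +
      ((Finset.univ.filter fun i => Module.finrank F ↥(W ⊓ LinearMap.ker (e i)) + 1 =
        Module.finrank F W).card : ℝ) / (Fintype.card F + 1) ≤ a := by
  set κ := Module.finrank F W with hκ
  set q : ℝ := (Fintype.card F : ℝ) with hq
  have hq2 : (2 : ℝ) ≤ q := by
    rw [hq]
    exact_mod_cast Fintype.one_lt_card (α := F)
  set P := Finset.univ.filter fun p : U => p ∈ W ∧ p ≠ 0 with hP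
  set Z := Finset.univ.filter fun i => W ≤ LinearMap.ker (e i) with hZ
  set Y := Finset.univ.filter fun i => Module.finrank F ↥(W ⊓ LinearMap.ker (e i)) + 1 = κ with hY
  have hPcard : (P.card : ℝ) = q ^ κ - 1 := by
    have := card_nonzero_add_one W
    rw [← hP, ← hκ] at this
    rw [eq_sub_iff_add_eq, hq]
    exact_mod_cast this
  have hcount : ∑ p ∈ P, ((Finset.univ.filter fun i => e i p = 0).card : ℝ) =
      ∑ i, ((P.filter fun p => e i p = 0).card : ℝ) := by
    simp only [Finset.card_filter, Nat.cast_sum]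
    exact Finset.sum_comm
  have hinter : ∀ i, ((P.filter fun p => e i p = 0).card : ℝ) =
      q ^ Module.finrank F ↥(W ⊓ LinearMap.ker (e i)) - 1 := by
    intro i
    have := card_nonzero_add_one (W ⊓ LinearMap.ker (e i))
    rw [eq_sub_iff_add_eq, hq]
    have heq : (P.filter fun p => e i p = 0) =
        Finset.univ.filter fun p : U => p ∈ W ⊓ LinearMap.ker (e i) ∧ p ≠ 0 := by
      ext p
      simp only [hP, Finset.mem_filter, Finset.mem_univ, true_and, Submodule.mem_inf,
        LinearMap.mem_ker]
      tauto
    rw [heq]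
    exact_mod_cast this
  have hlower : (Z.card : ℝ) * (q ^ κ - 1) + Y.card * (q ^ (κ - 1) - 1) ≤
      ∑ i, ((P.filter fun p => e i p = 0).card : ℝ) := by
    have hdisj : Disjoint Z Y := by
      rw [Finset.disjoint_left]
      intro i hi hi'
      have h1 := (Finset.mem_filter.1 hi).2
      have h2 := (Finset.mem_filter.1 hi').2
      rw [inf_eq_left.2 h1] at h2
      omega
    refine le_trans (le_of_eq ?_) (Finset.sum_le_sum_of_subset_of_nonneg
      (Finset.subset_univ (Z ∪ Y)) fun _ _ _ => Nat.cast_nonneg _)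
    rw [Finset.sum_union hdisj]
    congr 1
    · rw [← nsmul_eq_mul, ← Finset.sum_const]
      refine Finset.sum_congr rfl fun i hi => ?_
      rw [hinter, inf_eq_left.2 (Finset.mem_filter.1 hi).2]
    · rw [← nsmul_eq_mul, ← Finset.sum_const]
      refine Finset.sum_congr rfl fun i hi => ?_
      rw [hinter, ← (Finset.mem_filter.1 hi).2, Nat.add_sub_cancel]
  have hupper : ∑ p ∈ P, ((Finset.univ.filter fun i => e i p = 0).card : ℝ) ≤
      (q ^ κ - 1) * a := by
    rw [← hPcard, ← nsmul_eq_mul, ← Finset.sum_const]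
    exact Finset.sum_le_sum fun p hp =>
      ha p (Finset.mem_filter.1 hp).2.1 (Finset.mem_filter.1 hp).2.2
  have hmain := hlower.trans (hcount ▸ hupper)
  obtain ⟨r, hr⟩ : ∃ r, κ = r + 2 := ⟨κ - 2, by omega⟩
  have hrpos : (1 : ℝ) ≤ q ^ r := one_le_pow₀ (by linarith)
  have hfactor : q ^ κ - 1 ≤ (q + 1) * (q ^ (κ - 1) - 1) := by
    rw [hr, show r + 2 - 1 = r + 1 from rfl, pow_succ, pow_succ]
    nlinarith
  have hpos : 0 < q ^ κ - 1 := by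
    rw [hr, pow_succ, pow_succ]
    have : q ≤ q ^ r * q := by nlinarith
    nlinarith
  have hY0 : (0 : ℝ) ≤ Y.card := Nat.cast_nonneg _
  have hYle : (Y.card : ℝ) / (q + 1) * (q ^ κ - 1) ≤ Y.card * (q ^ (κ - 1) - 1) := by
    rw [div_mul_eq_mul_div, div_le_iff₀ (by linarith)]
    nlinarith [mul_le_mul_of_nonneg_left hfactor hY0]
  have : ((Z.card : ℝ) + Y.card / (q + 1)) * (q ^ κ - 1) ≤ a * (q ^ κ - 1) := by
    linarith [add_mul (Z.card : ℝ) (Y.card / (q + 1)) (q ^ κ - 1), mul_comm a (q ^ κ - 1)]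
  exact le_of_mul_le_mul_right this hpos

open Classical in
/-- A list whose members agree with the received word `c` in at least `μ` more places than any
nonzero difference vanishes has at most `β * b ^ dim` elements. -/
theorem card_list_le (e : ι → U →ₗ[F] M) (c : ι → M) {ω μ b β : ℝ}
    (hμ : 0 < μ) (hω : 0 < ω) (hι : (Fintype.card ι : ℝ) ≤ ω * μ)
    (hb : 1 ≤ b) (hβ : 1 ≤ β) (hβb : β * b = ω) (hbω : ω ≤ b ^ 2)
    (hbinv : 1 / ω + 1 / (Fintype.card F + 1) = 1 / b) (κ : ℕ) :
    ∀ (W : Submodule F U) (N : Finset U), Module.finrank F W = κ →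
      (∀ p ∈ N, ∀ p' ∈ N, p - p' ∈ W) →
      (∀ p ∈ N, ∀ p' ∈ W, p' ≠ 0 → ((Finset.univ.filter fun i => e i p' = 0).card : ℝ) + μ ≤
        (Finset.univ.filter fun i => e i p = c i).card) →
      (N.card : ℝ) ≤ β * b ^ κ := by
  induction κ using Nat.strong_induction_on with
  | _ κ ih =>
  intro W N hκ hdiff hagree
  set q : ℝ := (Fintype.card F : ℝ) with hq
  have hb0 : 0 < b := by linarith
  have hone : ∀ (W : Submodule F U) (N : Finset U), Module.finrank F W = 0 →
      (∀ p ∈ N, ∀ p' ∈ N, p - p' ∈ W) → N.card ≤ 1 := by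
    intro W N h0 hdiff
    rw [Finset.card_le_one]
    intro p hp p' hp'
    have := hdiff p hp p' hp'
    rw [Submodule.finrank_eq_zero.1 h0, Submodule.mem_bot] at this
    exact sub_eq_zero.1 this
  set Z := Finset.univ.filter fun i => W ≤ LinearMap.ker (e i) with hZ
  have hdiff' : ∀ i, ∀ p ∈ N.filter (fun p => e i p = c i), ∀ p' ∈ N.filter (fun p => e i p = c i),
      p - p' ∈ W ⊓ LinearMap.ker (e i) := by
    intro i p hp p' hp'
    rw [Finset.mem_filter] at hp hp'
    exact ⟨hdiff p hp.1 p' hp'.1,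
      LinearMap.mem_ker.2 (by rw [map_sub, hp.2, hp'.2, sub_self])⟩
  have hlt : ∀ i ∉ Z, Module.finrank F ↥(W ⊓ LinearMap.ker (e i)) < κ := by
    intro i hi
    rw [← hκ]
    refine Submodule.finrank_lt_finrank_of_lt (lt_of_le_of_ne inf_le_left fun h => hi ?_)
    exact Finset.mem_filter.2 ⟨Finset.mem_univ _, inf_eq_left.1 h⟩
  have hdouble : ∑ p ∈ N, (((Finset.univ.filter fun i => e i p = c i) \ Z).card : ℝ) =
      ∑ i ∈ Zᶜ, ((N.filter fun p => e i p = c i).card : ℝ) := by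
    have : ∀ p, (Finset.univ.filter fun i => e i p = c i) \ Z =
        Zᶜ.filter fun i => e i p = c i := by
      intro p
      ext i
      simp [and_comm]
    simp only [this, Finset.card_filter, Nat.cast_sum]
    exact Finset.sum_comm
  have hsdiff : ∀ p, ((Finset.univ.filter fun i => e i p = c i).card : ℝ) ≤
      Z.card + ((Finset.univ.filter fun i => e i p = c i) \ Z).card := by
    intro p
    have := Finset.card_le_card_sdiff_add_card (t := Z)
      (s := Finset.univ.filter fun i => e i p = c i)
    rw [add_comm]
    exact_mod_cast this
  rcases Nat.lt_or_ge κ 2 with hκ2 | hκ2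
  · interval_cases κ
    · have : (N.card : ℝ) ≤ 1 := by exact_mod_cast hone W N hκ hdiff
      simpa using this.trans hβ
    · rw [pow_one, hβb]
      obtain ⟨v, hv, hv0⟩ : ∃ v ∈ W, v ≠ 0 := by
        refine Submodule.exists_mem_ne_zero_of_ne_bot fun h => ?_
        rw [h, finrank_bot] at hκ
        omega
      have hlow : ∀ p ∈ N, μ ≤ (((Finset.univ.filter fun i => e i p = c i) \ Z).card : ℝ) := by
        intro p hp
        have h1 := hagree p hp v hv hv0
        have h2 := hsdiff p
        have h3 : (Z.card : ℝ) ≤ (Finset.univ.filter fun i => e i v = 0).card := by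
          refine Nat.cast_le.2 (Finset.card_le_card fun i hi => ?_)
          exact Finset.mem_filter.2 ⟨Finset.mem_univ _, (Finset.mem_filter.1 hi).2 hv⟩
        linarith
      have h1 : (N.card : ℝ) * μ ≤ Fintype.card ι := by
        rw [← nsmul_eq_mul, ← Finset.sum_const]
        refine (Finset.sum_le_sum hlow).trans ?_
        rw [hdouble]
        calc ∑ i ∈ Zᶜ, ((N.filter fun p => e i p = c i).card : ℝ) ≤ ∑ i ∈ Zᶜ, 1 := by
              refine Finset.sum_le_sum fun i hi => ?_
              have := hlt i (Finset.mem_compl.1 hi)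
              exact_mod_cast hone _ _ (by omega) (hdiff' i)
          _ ≤ Fintype.card ι := by
              rw [Finset.sum_const, nsmul_eq_mul, mul_one]
              exact_mod_cast Finset.card_le_univ _
      exact le_of_mul_le_mul_right (h1.trans hι) hμ
  · obtain ⟨r, rfl⟩ : ∃ r, κ = r + 2 := ⟨κ - 2, by omega⟩
    set Y := Finset.univ.filter fun i => Module.finrank F ↥(W ⊓ LinearMap.ker (e i)) + 1 =
      Module.finrank F W with hY
    have hYZ : Y ⊆ Zᶜ := by
      intro i hi
      rw [Finset.mem_compl]
      intro hi'
      have h1 := (Finset.mem_filter.1 hi').2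
      have h2 := (Finset.mem_filter.1 hi).2
      rw [inf_eq_left.2 h1] at h2
      omega
    have hlow : ∀ p ∈ N, μ + Y.card / (q + 1) ≤
        (((Finset.univ.filter fun i => e i p = c i) \ Z).card : ℝ) := by
      intro p hp
      have h1 := average_zeros e W (by omega)
        (a := (Finset.univ.filter fun i => e i p = c i).card - μ)
        (fun p' hp' h0 => le_sub_iff_add_le.2 (hagree p hp p' hp' h0))
      have h2 := hsdiff p
      linarith
    have hsub : ∀ i ∉ Z, ((N.filter fun p => e i p = c i).card : ℝ) ≤
        β * b ^ Module.finrank F ↥(W ⊓ LinearMap.ker (e i)) := by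
      intro i hi
      refine ih _ (hlt i hi) _ _ rfl (hdiff' i) fun p hp p' hp' h0 => ?_
      exact hagree p (Finset.mem_filter.1 hp).1 p' hp'.1 h0
    have hup : ∑ i ∈ Zᶜ, ((N.filter fun p => e i p = c i).card : ℝ) ≤
        Y.card * (β * b ^ (r + 1)) + (Zᶜ \ Y).card * (β * b ^ r) := by
      rw [← Finset.sum_sdiff hYZ, add_comm]
      refine add_le_add ?_ ?_
      · rw [← nsmul_eq_mul, ← Finset.sum_const]
        refine Finset.sum_le_sum fun i hi => (hsub i (Finset.mem_compl.1 (hYZ hi))).trans ?_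
        have := (Finset.mem_filter.1 hi).2
        rw [show Module.finrank F ↥(W ⊓ LinearMap.ker (e i)) = r + 1 by omega]
      · rw [← nsmul_eq_mul, ← Finset.sum_const]
        refine Finset.sum_le_sum fun i hi => ?_
        rw [Finset.mem_sdiff, Finset.mem_compl] at hi
        refine (hsub i hi.1).trans ?_
        have h1 := hlt i hi.1
        have h2 : Module.finrank F ↥(W ⊓ LinearMap.ker (e i)) + 1 ≠ Module.finrank F W := fun h =>
          hi.2 (Finset.mem_filter.2 ⟨Finset.mem_univ _, h⟩)
        exact mul_le_mul_of_nonneg_left (pow_le_pow_right₀ hb (by omega)) (by linarith)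
    have hcard : (Y.card : ℝ) + (Zᶜ \ Y).card ≤ ω * μ := by
      refine le_trans ?_ hι
      rw [← Nat.cast_add, Nat.cast_le, add_comm, Finset.card_sdiff_add_card_eq_card hYZ]
      exact Finset.card_le_univ _
    have hsum : (N.card : ℝ) * (μ + Y.card / (q + 1)) ≤
        Y.card * (β * b ^ (r + 1)) + (Zᶜ \ Y).card * (β * b ^ r) := by
      rw [← nsmul_eq_mul, ← Finset.sum_const]
      exact (Finset.sum_le_sum hlow).trans (hdouble ▸ hup)
    set y : ℝ := (Y.card : ℝ)
    set z : ℝ := ((Zᶜ \ Y).card : ℝ)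
    have hy : 0 ≤ y := Nat.cast_nonneg _
    have hz : 0 ≤ z := Nat.cast_nonneg _
    have hq0 : 0 ≤ q := Nat.cast_nonneg _
    have hμ' : (y + z) / ω ≤ μ := by
      rw [div_le_iff₀ hω, mul_comm]
      exact hcard
    have hden : y / b + z / ω ≤ μ + y / (q + 1) := by
      have : y / b = y / ω + y / (q + 1) := by
        rw [div_eq_mul_one_div y b, ← hbinv]
        ring
      have h2 : (y + z) / ω = y / ω + z / ω := add_div _ _ _
      linarith
    have hdpos : 0 < μ + y / (q + 1) := by positivity
    refine le_of_mul_le_mul_right (hsum.trans ?_) hdpos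
    calc y * (β * b ^ (r + 1)) + z * (β * b ^ r)
        ≤ y * (β * b ^ (r + 1)) + z * (β * b ^ r) * (b ^ 2 / ω) := by
          have : 1 ≤ b ^ 2 / ω := (one_le_div hω).2 hbω
          have h3 : 0 ≤ z * (β * b ^ r) := by positivity
          nlinarith
      _ = β * b ^ (r + 2) * (y / b + z / ω) := by
          field_simp
          ring
      _ ≤ _ := mul_le_mul_of_nonneg_left hden (by positivity)

end Averaging

section Numerics

theorem three_mul_sq_le_two_pow {m : ℕ} (hm : 8 ≤ m) : 3 * m ^ 2 ≤ 2 ^ m := by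
  induction m, hm using Nat.le_induction with
  | base => norm_num
  | succ m hm ih =>
    rw [pow_succ 2 m]
    nlinarith

theorem three_mul_pow_le_of_le {ω : ℕ} {q y₀ : ℝ} (hω : 0 < ω) (hq : 0 < q) (hy₀ : 0 ≤ y₀)
    (hy : y₀ ≤ q / ω + q / (q + 1)) (hpow : 3 * (ω : ℝ) ^ 2 ≤ y₀ ^ ω) :
    3 * (ω * (q + 1) / (ω + q + 1)) ^ (ω + 2) ≤ q ^ ω := by
  have hω' : (0 : ℝ) < ω := by exact_mod_cast hω
  set b := (ω : ℝ) * (q + 1) / (ω + q + 1) with hb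
  have hb0 : 0 < b := by positivity
  have hbω : b ≤ ω := by
    rw [hb, div_le_iff₀ (by positivity)]
    nlinarith
  have hby : (q / ω + q / (q + 1)) * b = q := by
    rw [hb]
    field_simp
    ring
  calc 3 * b ^ (ω + 2) = 3 * b ^ 2 * b ^ ω := by ring
    _ ≤ 3 * (ω : ℝ) ^ 2 * b ^ ω := by gcongr
    _ ≤ y₀ ^ ω * b ^ ω := by gcongr
    _ ≤ (q / ω + q / (q + 1)) ^ ω * b ^ ω := by gcongr
    _ = q ^ ω := by rw [← mul_pow, hby]

theorem div_add_div_mono {ω q₀ q : ℝ} (hω : 0 < ω) (hq₀ : 0 ≤ q₀) (h : q₀ ≤ q) :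
    q₀ / ω + q₀ / (q₀ + 1) ≤ q / ω + q / (q + 1) := by
  refine add_le_add (by gcongr) ?_
  rw [div_le_div_iff₀ (by linarith) (by linarith)]
  nlinarith

theorem three_mul_pow_le {ω q : ℕ} (hω : 2 ≤ ω) (hq : ω + 2 ≤ q) :
    3 * ((ω : ℝ) * (q + 1) / (ω + q + 1)) ^ (ω + 2) ≤ (q : ℝ) ^ ω := by
  have hq0 : (0 : ℝ) < q := by
    have : 0 < q := by omega
    exact_mod_cast this
  have hω0 : (0 : ℝ) < ω := by
    have : 0 < ω := by omega
    exact_mod_cast this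
  have large : ∀ q₀ : ℕ, q₀ ≤ q →
      3 * (ω : ℝ) ^ 2 ≤ ((q₀ : ℝ) / ω + q₀ / (q₀ + 1)) ^ ω →
      3 * ((ω : ℝ) * (q + 1) / (ω + q + 1)) ^ (ω + 2) ≤ (q : ℝ) ^ ω := fun q₀ h hp =>
    three_mul_pow_le_of_le (by omega) hq0 (by positivity)
      (div_add_div_mono hω0 (Nat.cast_nonneg _) (by exact_mod_cast h)) hp
  rcases Nat.lt_or_ge ω 8 with h8 | h8
  · interval_cases ω
    · rcases Nat.lt_or_ge q 6 with h | h
      · interval_cases q <;> norm_num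
      · exact large 6 h (by norm_num)
    · rcases Nat.lt_or_ge q 7 with h | h
      · interval_cases q <;> norm_num
      · exact large 7 h (by norm_num)
    · rcases Nat.lt_or_ge q 8 with h | h
      · interval_cases q <;> norm_num
      · exact large 8 h (by norm_num)
    · rcases Nat.lt_or_ge q 8 with h | h
      · interval_cases q
        norm_num
      · exact large 8 h (by norm_num)
    · exact large 8 hq (by norm_num)
    · exact large 9 hq (by norm_num)
  · refine three_mul_pow_le_of_le (y₀ := 2) (by omega) hq0 (by norm_num) ?_
      (by exact_mod_cast three_mul_sq_le_two_pow h8)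
    refine le_trans ?_ (div_add_div_mono hω0 (by positivity)
      (show (ω : ℝ) + 2 ≤ q by exact_mod_cast hq))
    rw [div_add_div _ _ hω0.ne' (by positivity), le_div_iff₀ (by positivity)]
    nlinarith

theorem two_pow_le_three_pow {m : ℕ} (hm : 2 ≤ m) : 2 ^ (m + 1) ≤ 3 ^ m := by
  induction m, hm using Nat.le_induction with
  | base => norm_num
  | succ m hm ih =>
    rw [pow_succ, pow_succ 3]
    omega

/-- The list size obtained by averaging is below `q ^ ℓ`. -/
theorem averaged_bound_le {ω q T ℓ : ℕ} (hω : 2 ≤ ω) (hq : ω + 2 ≤ q) (hT : ω + 1 ≤ T)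
    (hℓ : T * ω ≤ ℓ * (ω + 2)) :
    ((ω + q + 1 : ℝ) / (q + 1)) * ((ω : ℝ) * (q + 1) / (ω + q + 1)) ^ T ≤ (q : ℝ) ^ ℓ := by
  set b := (ω : ℝ) * (q + 1) / (ω + q + 1) with hb
  have hb0 : 0 ≤ b := by positivity
  have hβ : (ω + q + 1 : ℝ) / (q + 1) ≤ 2 := by
    rw [div_le_iff₀ (by positivity)]
    have : (ω : ℝ) + 2 ≤ q := by exact_mod_cast hq
    linarith
  have hq1 : (1 : ℝ) ≤ q := by
    have : 1 ≤ q := by omega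
    exact_mod_cast this
  have h23 : (2 : ℝ) ^ (ω + 2) ≤ 3 ^ T := by
    have h1 : (2 : ℝ) ^ (ω + 1 + 1) ≤ 3 ^ (ω + 1) := by
      exact_mod_cast two_pow_le_three_pow (m := ω + 1) (by omega)
    exact h1.trans (pow_le_pow_right₀ (by norm_num) hT)
  refine le_of_pow_le_pow_left₀ (n := ω + 2) (by omega) (by positivity) ?_
  calc ((ω + q + 1 : ℝ) / (q + 1) * b ^ T) ^ (ω + 2) ≤ (2 * b ^ T) ^ (ω + 2) := by gcongr
    _ = 2 ^ (ω + 2) * (b ^ (ω + 2)) ^ T := by rw [mul_pow, ← pow_mul, ← pow_mul, mul_comm T]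
    _ ≤ 3 ^ T * (b ^ (ω + 2)) ^ T := by gcongr
    _ = (3 * b ^ (ω + 2)) ^ T := by rw [mul_pow]
    _ ≤ ((q : ℝ) ^ ω) ^ T := by
      gcongr
      exact three_mul_pow_le hω hq
    _ = (q : ℝ) ^ (T * ω) := by rw [← pow_mul, mul_comm]
    _ ≤ (q : ℝ) ^ (ℓ * (ω + 2)) := pow_le_pow_right₀ hq1 hℓ
    _ = ((q : ℝ) ^ ℓ) ^ (ω + 2) := by rw [pow_mul]

theorem averaging_constants {ω q : ℕ} (hω : 2 ≤ ω) (hq : ω + 2 ≤ q) :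
    1 ≤ (ω : ℝ) * (q + 1) / (ω + q + 1) ∧ 1 ≤ (ω + q + 1 : ℝ) / (q + 1) ∧
    (ω + q + 1 : ℝ) / (q + 1) * ((ω : ℝ) * (q + 1) / (ω + q + 1)) = ω ∧
    (ω : ℝ) ≤ ((ω : ℝ) * (q + 1) / (ω + q + 1)) ^ 2 ∧
    1 / (ω : ℝ) + 1 / (q + 1) = 1 / ((ω : ℝ) * (q + 1) / (ω + q + 1)) := by
  have hω2 : (2 : ℝ) ≤ ω := by exact_mod_cast hω
  have hq2 : (ω : ℝ) + 2 ≤ q := by exact_mod_cast hq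
  have hω0 : (0 : ℝ) < ω := by linarith
  refine ⟨?_, ?_, ?_, ?_, ?_⟩
  · rw [le_div_iff₀ (by positivity)]
    nlinarith
  · rw [le_div_iff₀ (by positivity)]
    linarith
  · field_simp
  · rw [div_pow, le_div_iff₀ (by positivity)]
    obtain ⟨x, hx⟩ : ∃ x, ω = 2 + x := ⟨_, (Nat.add_sub_of_le hω).symm⟩
    obtain ⟨z, hz⟩ : ∃ z, q = ω + 2 + z := ⟨_, (Nat.add_sub_of_le hq).symm⟩
    rw [hz, hx, ← sub_nonneg]
    push_cast
    ring_nf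
    positivity
  · field_simp
    ring

end Numerics

section FewEigenvalues

variable {F : Type} [Field F] {L : Module.End F (MvPolynomial (Fin 2) F)}

theorem LinExt.evalAt_mul_eq_zero {s : ℕ}
    {G : Fin s → MvPolynomial (Fin 2) F →ₗ[F] MvPolynomial (Fin 2) F}
    {Mx My : Matrix (Fin s) (Fin s) (MvPolynomial (Fin 2) F)} (hext : LinExt F s G Mx My)
    (x : F × F) (Q : MvPolynomial (Fin 2) F) :
    ∀ p, (∀ i, evalAt x (G i p) = 0) → ∀ i, evalAt x (G i (Q * p)) = 0 := by
  induction Q using MvPolynomial.induction_on with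
  | C a =>
    intro p hp i
    rw [← smul_eq_C_mul, map_smul, evalAt_smul, hp, mul_zero]
  | add Q₁ Q₂ h₁ h₂ =>
    intro p hp i
    rw [add_mul, map_add, map_add, h₁ p hp, h₂ p hp, add_zero]
  | mul_X Q δ hQ =>
    intro p hp
    rw [mul_assoc]
    refine hQ _ fun i => ?_
    obtain ⟨M, hM⟩ : ∃ M : Matrix (Fin s) (Fin s) (MvPolynomial (Fin 2) F),
        ∀ p, (fun i => G i (X δ * p)) = M.mulVec fun i => G i p := by
      fin_cases δ
      exacts [⟨Mx, hext.1⟩, ⟨My, hext.2⟩]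
    have := congrFun (hM p) i
    simp only [Matrix.mulVec, dotProduct] at this
    rw [this, map_sum]
    exact Finset.sum_eq_zero fun j _ => by rw [map_mul, hp, mul_zero]

/-- Multiplying `p` by a suitable polynomial creates `m` zeros of `𝓣` in addition to the zeros of
`𝓛 p`. -/
theorem add_card_zeros_le {s n t k w d1 d2 D m : ℕ}
    {Mx My : Matrix (Fin s) (Fin s) (MvPolynomial (Fin 2) F)}
    (hext : LinExt F s (fun i : Fin s => L ^ (i : ℕ)) Mx My)
    (A : Fin n → F × F) (hw1 : 1 ≤ w) (hws : w ≤ s) (hd1 : t ≤ d1) (hd2 : k ≤ d2)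
    (hdist : ∀ R : MvPolynomial (Fin 2) F, R ≠ 0 → DegLT F d1 d2 R →
      D ≤ {i : Fin n |
        (fun j : Fin (s - w + 1) =>
          eval ![(A i).1, (A i).2] ((L ^ (j : ℕ)) R)) ≠ 0}.ncard)
    (hD : 0 < D) (hm : m * (s - w + 1) < (d1 - t + 1) * (d2 - k + 1))
    {p : MvPolynomial (Fin 2) F} (hp : p ∈ box F t k) (hp0 : p ≠ 0)
    (Z : Finset (Fin n)) (hZ : ∀ i ∈ Z, ∀ j : Fin s, evalAt (A i) ((L ^ (j : ℕ)) p) = 0) :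
    D + Z.card + m ≤ n := by
  classical
  have key : ∀ S : Finset (Fin n), S.card ≤ m → D + (Z ∪ S).card ≤ n := by
    intro S hS
    have hcount : S.card * (s - w + 1) < 1 * (d1 - t + 1) * (d2 - k + 1) := by
      rw [one_mul]
      exact (Nat.mul_le_mul_right _ hS).trans_lt hm
    let Θ : Fin 1 → Fin (s - w + 1) →
        MvPolynomial (Fin 2) F →ₗ[F] (Fin 1 → MvPolynomial (Fin 2) F) := fun _ j =>
      LinearMap.pi fun _ => (L ^ (j : ℕ)) ∘ₗ LinearMap.mulRight F p
    obtain ⟨Q, hQ0, hQbox, hQ⟩ := exists_interpolation Θ (fun x => A (S.equivFin.symm x))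
      (fun _ _ => 1) hcount
    have hQ00 : Q 0 ≠ 0 := fun h => hQ0 (funext fun i => by rw [Subsingleton.elim i 0]; exact h)
    have hbox : Q 0 * p ∈ box F d1 d2 := by
      have := mul_mem_box (hQbox 0) hp
      rwa [Nat.sub_add_cancel hd1, Nat.sub_add_cancel hd2] at this
    have hle := hdist _ (mul_ne_zero hQ00 hp0) hbox
    have hsub : {i : Fin n | (fun j : Fin (s - w + 1) =>
        eval ![(A i).1, (A i).2] ((L ^ (j : ℕ)) (Q 0 * p))) ≠ 0} ⊆ ((Z ∪ S)ᶜ : Finset (Fin n)) := by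
      intro i hi
      rw [Finset.mem_coe, Finset.mem_compl, Finset.mem_union]
      rintro (hiZ | hiS) <;> refine hi (funext fun j => ?_)
      · exact hext.evalAt_mul_eq_zero (A i) (Q 0) p (hZ i hiZ) ⟨j, by omega⟩
      · have := hQ (S.equivFin ⟨i, hiS⟩) j
        simpa [Θ] using this
    have h2 := Set.ncard_le_ncard hsub (Finset.finite_toSet _)
    rw [Set.ncard_coe_finset] at h2
    have h3 := Finset.card_add_card_compl (Z ∪ S)
    rw [Fintype.card_fin] at h3
    omega
  rcases le_total m Zᶜ.card with h | h
  · obtain ⟨S, hSZ, hS⟩ := Finset.exists_subset_card_eq h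
    have := key S hS.le
    rw [Finset.card_union_of_disjoint, hS] at this
    · omega
    · exact Finset.disjoint_left.2 fun i hi hi' => Finset.mem_compl.1 (hSZ hi') hi
  · have := key Zᶜ h
    rw [Finset.union_compl, Finset.card_univ, Fintype.card_fin] at this
    omega

/-- The list bound obtained by averaging. -/
theorem list_bound_of_averaging [Fintype F] {s n t k w d1 d2 D : ℕ}
    {Mx My : Matrix (Fin s) (Fin s) (MvPolynomial (Fin 2) F)}
    (hext : LinExt F s (fun i : Fin s => L ^ (i : ℕ)) Mx My)
    (A : Fin n → F × F) (hw1 : 1 ≤ w) (hws : w + 1 ≤ s) (hs : 3 ≤ s)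
    (hq : s + 1 ≤ Fintype.card F) (hd1 : t ≤ d1) (hd2 : k ≤ d2)
    (hcount : n * (s - w + 1) < w * (d1 - t + 1) * (d2 - k + 1))
    (hdist : ∀ R : MvPolynomial (Fin 2) F, R ≠ 0 → DegLT F d1 d2 R →
      D ≤ {i : Fin n |
        (fun j : Fin (s - w + 1) =>
          eval ![(A i).1, (A i).2] ((L ^ (j : ℕ)) R)) ≠ 0}.ncard)
    (c : Fin n → Fin s → F) :
    ({p : MvPolynomial (Fin 2) F | DegLT F t k p ∧
      {i : Fin n |
        (fun j : Fin s => eval ![(A i).1, (A i).2] ((L ^ (j : ℕ)) p)) ≠ c i}.ncard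
        < D}.ncard : ℝ) ≤
      (((s - 1 : ℕ) : ℝ) + Fintype.card F + 1) / (Fintype.card F + 1) *
        (((s - 1 : ℕ) : ℝ) * (Fintype.card F + 1) /
          (((s - 1 : ℕ) : ℝ) + Fintype.card F + 1)) ^ (t * k) := by
  classical
  have : Finite (box F t k) := Module.finite_of_finite F
  let _ : Fintype (box F t k) := Fintype.ofFinite _
  set S := {p : MvPolynomial (Fin 2) F | DegLT F t k p ∧
      {i : Fin n |
        (fun j : Fin s => eval ![(A i).1, (A i).2] ((L ^ (j : ℕ)) p)) ≠ c i}.ncard < D} with hS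
  let e : Fin n → box F t k →ₗ[F] (Fin s → F) := fun i =>
    { toFun := fun p j => evalAt (A i) ((L ^ (j : ℕ)) p)
      map_add' := fun p p' => by
        funext j
        simp
      map_smul' := fun a p => by
        funext j
        rw [Submodule.coe_smul, map_smul, evalAt_smul]
        rfl }
  let N : Finset (box F t k) := Finset.univ.filter fun p => (p : MvPolynomial (Fin 2) F) ∈ S
  have hN : S.ncard = N.card := by
    have : S = (fun p : box F t k => (p : MvPolynomial (Fin 2) F)) '' (N : Set (box F t k)) := by
      ext p
      constructor
      · intro hp
        exact ⟨⟨p, hp.1⟩, by simpa [N] using hp, rfl⟩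
      · rintro ⟨p, hp, rfl⟩
        simpa [N] using hp
    rw [this, Set.ncard_image_of_injective _ Subtype.val_injective, Set.ncard_coe_finset]
  obtain ⟨m, hm1, hm2⟩ : ∃ m, m * (s - w + 1) < (d1 - t + 1) * (d2 - k + 1) ∧
      (d1 - t + 1) * (d2 - k + 1) ≤ (m + 1) * (s - w + 1) := by
    have hpos : 0 < (d1 - t + 1) * (d2 - k + 1) := by positivity
    generalize (d1 - t + 1) * (d2 - k + 1) = d at hpos
    refine ⟨(d - 1) / (s - w + 1), ?_, ?_⟩
    · have := Nat.div_mul_le_self (d - 1) (s - w + 1)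
      omega
    · have := Nat.lt_mul_div_succ (d - 1) (show 0 < s - w + 1 by omega)
      rw [mul_comm] at this
      omega
  have hn : n ≤ (s - 1) * (m + 1) := by
    have h1 : n * (s - w + 1) < w * (m + 1) * (s - w + 1) := by
      refine hcount.trans_le ?_
      rw [mul_assoc, mul_assoc]
      exact Nat.mul_le_mul_left _ hm2
    exact (Nat.lt_of_mul_lt_mul_right h1).le.trans (Nat.mul_le_mul_right _ (by omega))
  obtain ⟨h1, h2, h3, h4, h5⟩ :=
    averaging_constants (ω := s - 1) (q := Fintype.card F) (by omega) (by omega)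
  rw [hN]
  refine card_list_le e c (ω := (s - 1 : ℕ)) (μ := (m : ℝ) + 1) (by positivity)
    (by exact_mod_cast (show 0 < s - 1 by omega)) ?_ h1 h2 h3 h4 h5 (t * k) ⊤ N ?_
    (fun _ _ _ _ => Submodule.mem_top) ?_
  · rw [Fintype.card_fin]
    exact_mod_cast hn
  · rw [finrank_top, finrank_box]
  · intro p hp p' _ hp0
    have hpS : (p : MvPolynomial (Fin 2) F) ∈ S := (Finset.mem_filter.1 hp).2
    have hzeros := add_card_zeros_le hext A hw1 (by omega) hd1 hd2 hdist
      (Nat.zero_lt_of_lt hpS.2) hm1 p'.2 (fun h => hp0 (Subtype.ext h))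
      (Finset.univ.filter fun i => e i p' = 0)
      (fun i hi j => congrFun (Finset.mem_filter.1 hi).2 j)
    have hdis := hpS.2
    have hset : {i : Fin n | (fun j : Fin s => eval ![(A i).1, (A i).2]
        ((L ^ (j : ℕ)) (p : MvPolynomial (Fin 2) F))) ≠ c i} =
        ((Finset.univ.filter fun i => e i p = c i)ᶜ : Finset (Fin n)) := by
      ext i
      simp [e]
    rw [hset, Set.ncard_coe_finset] at hdis
    have hcompl := Finset.card_add_card_compl (Finset.univ.filter fun i => e i p = c i)
    rw [Fintype.card_fin] at hcompl
    have hle : (((Finset.univ.filter fun i => e i p' = 0).card : ℕ) : ℝ) + (m + 1) ≤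
        (Finset.univ.filter fun i => e i p = c i).card := by
      rw [← add_assoc]
      exact_mod_cast (show (Finset.univ.filter fun i => e i p' = 0).card + m + 1 ≤
        (Finset.univ.filter fun i => e i p = c i).card by omega)
    convert hle

open Classical in
theorem card_diagAt_mem_le (hL : DegPres L) {s t k ℓ : ℕ}
    (hdiag : ∀ u : Fin s → F, u ≠ 0 →
      {ab : Fin t × Fin k |
        (∑ j, u j * diagEntry F (L ^ (j : ℕ)) ab.1 ab.2) = 0}.ncard ≤ ℓ)
    {R : Finset F} (hR : R.card < s) :
    (Finset.univ.filter fun ab : Fin t × Fin k => diagAt L (expo ab.1 ab.2) ∈ R).card ≤ ℓ := by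
  set f : Polynomial F := ∏ x ∈ R, (Polynomial.X - Polynomial.C x) with hf
  have hmonic : f.Monic := Polynomial.monic_prod_X_sub_C _ _
  have hdeg : f.natDegree = R.card := Polynomial.natDegree_finsetProd_X_sub_C_eq_card R id
  have hu : (fun j : Fin s => f.coeff j) ≠ 0 := by
    intro h
    have := congrFun h ⟨f.natDegree, hdeg ▸ hR⟩
    exact one_ne_zero (hmonic.coeff_natDegree.symm.trans this)
  refine le_trans ?_ (hdiag _ hu)
  rw [← Set.ncard_coe_finset]
  refine Set.ncard_le_ncard (fun ab hab => ?_) (Set.toFinite _)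
  have hmem := (Finset.mem_filter.1 (Finset.mem_coe.1 hab)).2
  change _ = _
  simp only [diagEntry_eq_diagAt, hL.diagAt_pow]
  rw [Fin.sum_univ_eq_sum_range (fun j => f.coeff j * diagAt L (expo ab.1 ab.2) ^ j),
    ← Polynomial.eval_eq_sum_range' (hdeg ▸ hR), hf, Polynomial.eval_prod]
  exact Finset.prod_eq_zero hmem (by simp)

/-- The `r` largest of the values of `f` have at least the average sum. -/
theorem exists_subset_mul_sum_le {α : Type} [DecidableEq α] (f : α → ℕ) (r : ℕ) (V : Finset α)
    (hr : r ≤ V.card) :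
    ∃ R ⊆ V, R.card = r ∧ r * ∑ x ∈ V, f x ≤ V.card * ∑ x ∈ R, f x := by
  induction hv : V.card - r generalizing V with
  | zero => exact ⟨V, subset_rfl, by omega, by rw [show r = V.card by omega]⟩
  | succ v ih =>
    have hne : V.Nonempty := Finset.card_pos.1 (by omega)
    obtain ⟨x, hx, hmin⟩ := Finset.exists_min_image V f hne
    have hcard := Finset.card_erase_of_mem hx
    obtain ⟨R, hRV, hRr, hR⟩ := ih (V.erase x) (by omega) (by omega)
    refine ⟨R, hRV.trans (Finset.erase_subset _ _), hRr, ?_⟩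
    rcases Nat.eq_zero_or_pos r with rfl | hr0
    · simp
    obtain ⟨N, hN⟩ : ∃ N, V.card = N + 2 := ⟨V.card - 2, by omega⟩
    rw [hcard, hN, show N + 2 - 1 = N + 1 from rfl] at hR
    rw [← Finset.add_sum_erase V f hx, hN]
    have hle : (N + 1) * f x ≤ ∑ y ∈ V.erase x, f y := by
      have := Finset.card_nsmul_le_sum (V.erase x) f (f x)
        fun y hy => hmin y (Finset.mem_of_mem_erase hy)
      rwa [hcard, hN, smul_eq_mul] at this
    refine Nat.le_of_mul_le_mul_left (c := N + 1) ?_ (by omega)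
    set E := ∑ y ∈ V.erase x, f y
    set G := ∑ y ∈ R, f y
    calc (N + 1) * (r * (f x + E)) = r * ((N + 1) * f x) + (N + 1) * (r * E) := by ring
      _ ≤ r * E + (N + 1) * (r * E) := by gcongr
      _ = (N + 2) * (r * E) := by ring
      _ ≤ (N + 2) * ((N + 1) * G) := by gcongr
      _ = (N + 1) * ((N + 2) * G) := by ring

end FewEigenvalues

theorem LinExt.affine_of_two {F : Type} [Field F] {L : Module.End F (MvPolynomial (Fin 2) F)}
    {Mx My : Matrix (Fin 2) (Fin 2) (MvPolynomial (Fin 2) F)}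
    (hext : LinExt F 2 (fun i : Fin 2 => L ^ (i : ℕ)) Mx My) (δ : Fin 2) :
    ∃ A B, ∀ p, L (X δ * p) = A * L p + B * p := by
  obtain ⟨M, hM⟩ : ∃ M : Matrix (Fin 2) (Fin 2) (MvPolynomial (Fin 2) F),
      ∀ p, (fun i : Fin 2 => (L ^ (i : ℕ)) (X δ * p)) = M.mulVec fun i => (L ^ (i : ℕ)) p := by
    fin_cases δ
    exacts [⟨Mx, hext.1⟩, ⟨My, hext.2⟩]
  refine ⟨M 1 1, M 1 0, fun p => ?_⟩
  have := congrFun (hM p) 1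
  simp only [Matrix.mulVec, dotProduct, Fin.sum_univ_two, Fin.val_zero, Fin.val_one, pow_zero,
    pow_one, Module.End.one_apply] at this
  rw [this, add_comm]

/-- List-decoding theorem for power families of bivariate linear operators
(Theorem 1.3), where `𝓛 = (L^0, …, L^(s-1))` and `𝓣 = (L^0, …, L^(s-w))`. -/
theorem list_decoding_power_family
    {F : Type} [Field F] [Fintype F] {q s n t k w d1 d2 D ℓ : ℕ}
    (hq : Fintype.card F = q)
    (L : Module.End F (MvPolynomial (Fin 2) F))
    (hdegL : ∀ p : MvPolynomial (Fin 2) F, p ≠ 0 →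
      L p ≠ 0 ∧ (L p).degreeOf 0 = p.degreeOf 0 ∧ (L p).degreeOf 1 = p.degreeOf 1)
    (A : Fin n → F × F)
    (htk : t * k ≤ s * n)
    (Mx My : Matrix (Fin s) (Fin s) (MvPolynomial (Fin 2) F))
    (hext : LinExt F s (fun i : Fin s => L ^ (i : ℕ)) Mx My)
    (hw1 : 1 ≤ w) (hws : w ≤ s)
    (hd1 : t ≤ d1) (hd2 : k ≤ d2)
    (hcount : n * (s - w + 1) < w * (d1 - t + 1) * (d2 - k + 1))
    (hdist : ∀ R : MvPolynomial (Fin 2) F, R ≠ 0 → DegLT F d1 d2 R →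
      D ≤ {i : Fin n |
        (fun j : Fin (s - w + 1) =>
          eval ![(A i).1, (A i).2] ((L ^ (j : ℕ)) R)) ≠ 0}.ncard)
    (hdiag : ∀ u : Fin s → F, u ≠ 0 →
      {ab : Fin t × Fin k |
        (∑ j, u j * diagEntry F (L ^ (j : ℕ)) ab.1 ab.2) = 0}.ncard ≤ ℓ)
    (c : Fin n → Fin s → F) :
    {p : MvPolynomial (Fin 2) F | DegLT F t k p ∧
      {i : Fin n |
        (fun j : Fin s => eval ![(A i).1, (A i).2] ((L ^ (j : ℕ)) p)) ≠ c i}.ncard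
        < D}.Finite ∧
    {p : MvPolynomial (Fin 2) F | DegLT F t k p ∧
      {i : Fin n |
        (fun j : Fin s => eval ![(A i).1, (A i).2] ((L ^ (j : ℕ)) p)) ≠ c i}.ncard
        < D}.ncard ≤ q ^ ℓ := by
  classical
  subst hq
  have hL : DegPres L := hdegL
  have hbox : Finite (box F t k) := Module.finite_of_finite F
  have hboxfin : (box F t k : Set (MvPolynomial (Fin 2) F)).Finite := hbox
  refine ⟨hboxfin.subset fun p hp => hp.1, ?_⟩
  rcases Nat.lt_or_ge ℓ (t * k) with hℓ | hℓ
  swap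
  · refine (Set.ncard_le_ncard (fun p hp => hp.1) hboxfin).trans
      (le_trans (le_of_eq ?_) (Nat.pow_le_pow_right Fintype.card_pos hℓ))
    have := Module.natCard_eq_pow_finrank (K := F) (V := box F t k)
    rw [finrank_box, Nat.card_eq_fintype_card (α := F)] at this
    exact this
  let φ : Fin t × Fin k → F := fun ab => diagAt L (expo ab.1 ab.2)
  set V := Finset.univ.image φ with hV
  have hVs : s ≤ V.card := by
    by_contra! h
    have := card_diagAt_mem_le hL hdiag h
    rw [Finset.filter_true_of_mem fun ab _ => Finset.mem_image_of_mem φ (Finset.mem_univ ab)] at this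
    simp only [Finset.card_univ, Fintype.card_prod, Fintype.card_fin] at this
    omega
  have hVT : V.card ≤ t * k := by
    refine Finset.card_image_le.trans (le_of_eq ?_)
    simp
  by_cases haff : CombClosed L s w
  · exact list_bound_of_combClosed hL haff A hws hd1 hd2 hcount hdist hdiag c
  have hws' : w + 1 ≤ s := by
    by_contra! h
    obtain rfl : w = s := by omega
    exact haff (combClosed_self w)
  have hs3 : 3 ≤ s := by
    by_contra! h
    obtain rfl : s = 2 := by omega
    exact haff (combClosed_of_affine hws hext.affine_of_two)
  let E : Finset F := Finset.univ.filter fun x => ∃ a b, diagAt L (expo a b) = x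
  have hE : ∀ x, x ∈ E ↔ ∃ a b, diagAt L (expo a b) = x := fun x => by simp [E]
  have hEs : E.card ≤ s + 1 := by
    by_contra! h
    exact haff (combClosed_of_affine hws (exists_affine_of_card hL hs3 h hE hext))
  have hVE : V.card ≤ E.card := by
    refine Finset.card_le_card fun x hx => ?_
    obtain ⟨ab, -, rfl⟩ := Finset.mem_image.1 hx
    exact (hE _).2 ⟨ab.1, ab.2, rfl⟩
  have hqs : s + 1 ≤ Fintype.card F := by
    have h0 : (0 : F) ∉ E := fun h => by
      obtain ⟨a, b, hab⟩ := (hE 0).1 h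
      exact hL.diagAt_ne_zero _ hab
    have := Finset.card_le_univ (insert 0 E)
    rw [Finset.card_insert_of_notMem h0] at this
    omega
  have hℓs : t * k * (s - 1) ≤ ℓ * (s - 1 + 2) := by
    obtain ⟨R, -, hRcard, hR⟩ := exists_subset_mul_sum_le
      (fun x => (Finset.univ.filter fun ab => φ ab = x).card) (s - 1) V (by omega)
    have hsumV : ∑ x ∈ V, (Finset.univ.filter fun ab => φ ab = x).card = t * k := by
      rw [← Finset.card_eq_sum_card_image]
      simp
    have hsumR : ∑ x ∈ R, (Finset.univ.filter fun ab => φ ab = x).card ≤ ℓ := by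
      refine le_trans (le_of_eq ?_) (card_diagAt_mem_le hL hdiag (R := R) (by omega))
      have hmaps : Set.MapsTo φ (Finset.univ.filter fun ab => φ ab ∈ R) (R : Set F) :=
        fun ab hab => (Finset.mem_filter.1 (Finset.mem_coe.1 hab)).2
      refine Eq.trans ?_ (Finset.card_eq_sum_card_fiberwise hmaps).symm
      refine Finset.sum_congr rfl fun x hx => ?_
      congr 1
      ext ab
      simp only [Finset.mem_filter, Finset.mem_univ, true_and]
      exact ⟨fun h => ⟨by rwa [h], h⟩, fun h => h.2⟩
    rw [hsumV] at hR
    calc t * k * (s - 1) = (s - 1) * (t * k) := mul_comm _ _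
      _ ≤ V.card * _ := hR
      _ ≤ (s - 1 + 2) * ℓ := Nat.mul_le_mul (by omega) hsumR
      _ = ℓ * (s - 1 + 2) := mul_comm _ _
  have h1 := list_bound_of_averaging hext A hw1 hws' hs3 hqs hd1 hd2 hcount hdist c
  have h2 := averaged_bound_le (ω := s - 1) (q := Fintype.card F) (T := t * k) (ℓ := ℓ)
    (by omega) (by omega) (by omega) hℓs
  exact_mod_cast h1.trans h2
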